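/- arXiv:2212.05362 — 5 statements merged into one kernel-verified Lean document; each statement's English description precedes it below -/
import Mathlib

section
/- The number of Stembridge codes of length n with index j equals the Eulerian number A(n,j), the number of permutations of [n] with exactly j descents. -/
open Finset

/-- number of occurrences of `k` in `α` -/
def occ {n : ℕ} (α : Fin n → ℕ) (k : ℕ) : ℕ :=
  (Finset.univ.filter fun i => α i = k).card

/-- maximum entry of `α` -/
def maxVal {n : ℕ} (α : Fin n → ℕ) : ℕ :=
  Finset.univ.sup α

/-- `(α, f)` is a Stembridge code -/
def IsCode {n : ℕ} (α : Fin n → ℕ) (f : ℕ → ℕ) : Prop :=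
  (∀ k, 1 ≤ k → k ≤ maxVal α → 2 ≤ occ α k) ∧
  (∀ k, 1 ≤ k → k ≤ maxVal α → 1 ≤ f k ∧ f k ≤ occ α k - 1) ∧
  (∀ k, k = 0 ∨ maxVal α < k → f k = 0)

/-- the index of a Stembridge code -/
def codeIndex {n : ℕ} (α : Fin n → ℕ) (f : ℕ → ℕ) : ℕ :=
  ∑ k ∈ Finset.Icc 1 (maxVal α), f k

/-- Stembridge codes of length `n` -/
def StembridgeCode (n : ℕ) :=
  {p : (Fin n → ℕ) × (ℕ → ℕ) // IsCode p.1 p.2}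

/-- number of descents of a permutation of `Fin n` -/
noncomputable def des {n : ℕ} (σ : Equiv.Perm (Fin n)) : ℕ :=
  Nat.card {i : Fin n // ∃ h : (i : ℕ) + 1 < n, σ ⟨(i : ℕ) + 1, h⟩ < σ i}


namespace Stem

def cn {n : ℕ} {κ : Type*} [DecidableEq κ] (α : Fin n → κ) (k : κ) : ℕ :=
  (Finset.univ.filter fun i => α i = k).card

section alg
variable {R : Type*} [CommRing R]

def w (t : R) (c : ℕ) : R := ∑ i ∈ Finset.Ico 1 c, t ^ i

def lam (t : R) : Fin 3 → R := ![t, -1, 1 - t]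
def xx (t : R) : Fin 3 → R := ![1, t, 0]

lemma w_mul (t : R) (c : ℕ) : (1 - t) * w t c = ∑ e : Fin 3, lam t e * xx t e ^ c := by
  have h : ∀ c : ℕ, (1 - t) * w t (c + 1) = t - t ^ (c + 1) := by
    intro c
    induction c with
    | zero => simp [w]
    | succ c ih =>
      have : w t (c + 1 + 1) = w t (c + 1) + t ^ (c + 1) := by
        unfold w
        rw [Finset.sum_Ico_succ_top (by omega)]
      rw [this, mul_add, ih]; ring
  cases c with
  | zero => simp [w, lam, xx, Fin.sum_univ_three]; ring
  | succ c => rw [h]; simp [lam, xx, Fin.sum_univ_three]; ring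

lemma sum_prod_pow {κ : Type*} [Fintype κ] [DecidableEq κ] (n : ℕ) (x : κ → R) :
    ∑ α : Fin n → κ, ∏ k, x k ^ cn α k = (∑ k, x k) ^ n := by
  rw [Fintype.sum_pow]
  refine Finset.sum_congr rfl fun α _ => ?_
  rw [← Finset.prod_fiberwise' univ α x]
  simp [cn]

def Cm (t : R) (n m : ℕ) (y : R) : R :=
  ∑ α : Fin n → Fin (m + 1), y ^ cn α 0 * ∏ k : Fin m, w t (cn α k.succ)

def G (t : R) (n m : ℕ) (y : R) : R :=
  ∑ e : Fin m → Fin 3, (∏ k, lam t (e k)) * (y + ∑ k, xx t (e k)) ^ n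

lemma Cm_G (t : R) (n m : ℕ) (y : R) : (1 - t) ^ m * Cm t n m y = G t n m y := by
  unfold Cm G
  have : ∀ α : Fin n → Fin (m + 1),
      (1 - t) ^ m * (y ^ cn α 0 * ∏ k : Fin m, w t (cn α k.succ)) =
      ∑ e : Fin m → Fin 3, (∏ k, lam t (e k)) *
        ∏ k : Fin (m + 1), (Fin.cons y (fun k => xx t (e k)) : Fin (m + 1) → R) k ^ cn α k := by
    intro α
    have h1 : (1 - t) ^ m * ∏ k : Fin m, w t (cn α k.succ) =
        ∏ k : Fin m, ∑ e : Fin 3, lam t e * xx t e ^ cn α k.succ := by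
      simp_rw [← w_mul, Finset.prod_mul_distrib]
      simp
    rw [mul_left_comm, h1, Finset.prod_univ_sum, Fintype.piFinset_univ, Finset.mul_sum]
    refine Finset.sum_congr rfl fun e _ => ?_
    rw [Fin.prod_univ_succ, Finset.prod_mul_distrib]
    simp
    ring
  rw [Finset.mul_sum, Finset.sum_congr rfl fun α _ => this α, Finset.sum_comm]
  refine Finset.sum_congr rfl fun e _ => ?_
  rw [← Finset.mul_sum, sum_prod_pow, Fin.sum_univ_succ]
  simp

lemma G_succ (t : R) (n m : ℕ) (y : R) :
    G t n (m + 1) y = t * G t n m (y + 1) - G t n m (y + t) + (1 - t) * G t n m y := by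
  unfold G
  rw [← (Fin.consEquiv fun _ : Fin (m + 1) => Fin 3).sum_comp, Fintype.sum_prod_type,
    Fin.sum_univ_three]
  simp [Fin.consEquiv, Fin.prod_univ_succ, Fin.sum_univ_succ, lam, xx, Finset.mul_sum, mul_assoc,
    add_assoc, sub_eq_add_neg]

lemma Cm_succ [IsDomain R] (t : R) (ht : 1 - t ≠ 0) (n m : ℕ) (y : R) :
    Cm t n m (y + t) - t * Cm t n m (y + 1) = (1 - t) * (Cm t n m y - Cm t n (m + 1) y) := by
  have h := G_succ t n m y
  rw [← Cm_G, ← Cm_G, ← Cm_G, ← Cm_G] at h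
  apply mul_left_cancel₀ (pow_ne_zero m ht)
  linear_combination h

lemma Cm_zero (t : R) (n : ℕ) (y : R) : Cm t n 0 y = y ^ n := by
  have : ∀ α : Fin n → Fin 1, cn α 0 = n := by
    intro α
    have : ∀ i, α i = 0 := fun i => Subsingleton.elim _ _
    simp [cn, this]
  simp [Cm, this]

lemma Cm_big (t : R) (n m : ℕ) (y : R) (h : n < m) : Cm t n m y = 0 := by
  unfold Cm
  refine Finset.sum_eq_zero fun α _ => ?_
  have : ∃ k : Fin m, ∀ i, α i ≠ k.succ := by
    by_contra! hc
    choose g hg using hc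
    have hinj : Function.Injective g := by
      intro a b hab
      have := hg a
      rw [hab, hg b] at this
      exact (Fin.succ_injective _ this).symm
    have := Fintype.card_le_of_injective g hinj
    simp at this
    omega
  obtain ⟨k, hk⟩ := this
  rw [Finset.prod_eq_zero (mem_univ k), mul_zero]
  have : cn α k.succ = 0 := by simp [cn, hk]
  simp [this, w]

def Ctot (t : R) (n : ℕ) (y : R) : R := ∑ m ∈ range (n + 1), Cm t n m y

lemma Ctot_rec [IsDomain R] (t : R) (ht : 1 - t ≠ 0) (n : ℕ) (y : R) :
    Ctot t n (y + t) - t * Ctot t n (y + 1) = (1 - t) * y ^ n := by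
  unfold Ctot
  rw [Finset.mul_sum, ← Finset.sum_sub_distrib]
  simp_rw [Cm_succ t ht]
  rw [← Finset.mul_sum, Finset.sum_range_sub', Cm_zero, Cm_big t n (n + 1) y (by omega), sub_zero]

lemma Ctot_N [IsDomain R] (t : R) (ht : 1 - t ≠ 0) (n N : ℕ) :
    Ctot t n 1 = t ^ N * Ctot t n (1 + N * (1 - t)) +
      (1 - t) ^ (n + 1) * ∑ j ∈ range N, t ^ j * ((j : R) + 1) ^ n := by
  induction N with
  | zero => simp
  | succ N ih =>
    rw [ih, Finset.sum_range_succ]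
    have h := Ctot_rec t ht n ((N + 1) * (1 - t))
    rw [mul_pow] at h
    have e1 : ((N : R) + 1) * (1 - t) + t = 1 + N * (1 - t) := by ring
    have e2 : ((N : R) + 1) * (1 - t) + 1 = 1 + ((N + 1 : ℕ) : R) * (1 - t) := by push_cast; ring
    rw [e1, e2] at h
    linear_combination t ^ N * h

end alg

open PowerSeries in
lemma Ctot_eq (n : ℕ) : Ctot (X : ℤ⟦X⟧) n 1 =
    (1 - X) ^ (n + 1) * PowerSeries.mk (fun j => ((j : ℤ) + 1) ^ n) := by
  ext d
  have ht : (1 - X : ℤ⟦X⟧) ≠ 0 := by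
    intro h
    have := congrArg (PowerSeries.coeff 0) h
    simp at this
  have hF : ∃ r : ℤ⟦X⟧, PowerSeries.mk (fun j => ((j : ℤ) + 1) ^ n) =
      ∑ j ∈ range (d + 1), X ^ j * ((j : ℤ⟦X⟧) + 1) ^ n + X ^ (d + 1) * r := by
    have : (X : ℤ⟦X⟧) ^ (d + 1) ∣ PowerSeries.mk (fun j => ((j : ℤ) + 1) ^ n) -
      ∑ j ∈ range (d + 1), X ^ j * ((j : ℤ⟦X⟧) + 1) ^ n := by
      rw [PowerSeries.X_pow_dvd_iff]
      intro m hm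
      have : ∀ j : ℕ, PowerSeries.coeff m (X ^ j * ((j : ℤ⟦X⟧) + 1) ^ n) =
          if m = j then ((j : ℤ) + 1) ^ n else 0 := by
        intro j
        have : ((j : ℤ⟦X⟧) + 1) ^ n = PowerSeries.C (((j : ℤ) + 1) ^ n) := by simp
        rw [this, PowerSeries.coeff_mul_C, PowerSeries.coeff_X_pow]
        split_ifs <;> simp
      simp only [map_sub, PowerSeries.coeff_mk, map_sum, this]
      rw [Finset.sum_ite_eq]
      simp [hm]
    obtain ⟨r, hr⟩ := this
    exact ⟨r, by rw [← hr]; ring⟩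
  obtain ⟨r, hr⟩ := hF
  rw [Ctot_N X ht n (d + 1), hr, mul_add, map_add, map_add, mul_left_comm,
    PowerSeries.coeff_X_pow_mul', PowerSeries.coeff_X_pow_mul']
  simp


lemma sm_ge {n M : ℕ} (h : Fin n ↪o Fin M) (i : ℕ) (hi : i < n) : i ≤ (h ⟨i, hi⟩).val := by
  induction i with
  | zero => omega
  | succ i ih =>
    have h1 := ih (by omega)
    have h2 : h ⟨i, by omega⟩ < h ⟨i + 1, hi⟩ := h.strictMono (by simp)
    have h3 : (h ⟨i, by omega⟩).val < (h ⟨i + 1, hi⟩).val := h2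
    omega

lemma sm_le {n M : ℕ} (h : Fin n ↪o Fin M) (k i : ℕ) (hi : i < n) (hk : i + k + 1 = n) :
    (h ⟨i, hi⟩).val + k < M := by
  induction k generalizing i with
  | zero => simp
  | succ k ih =>
    have h1 := ih (i + 1) (by omega) (by omega)
    have h2 : h ⟨i, by omega⟩ < h ⟨i + 1, by omega⟩ := h.strictMono (by simp)
    have h3 : (h ⟨i, by omega⟩).val < (h ⟨i + 1, by omega⟩).val := h2
    omega

def S1 (n N : ℕ) (P : ℕ → Prop) : Type :=
  {g : Fin n → Fin (N + 1) // ∀ (i : ℕ) (h : i + 1 < n),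
    g ⟨i, by omega⟩ ≤ g ⟨i + 1, h⟩ ∧ (P i → g ⟨i, by omega⟩ < g ⟨i + 1, h⟩)}

lemma count_lip (P : ℕ → Prop) [DecidablePred P] (a b : ℕ) :
    Nat.count P (a + b) ≤ Nat.count P a + b := by
  rw [Nat.count_add]
  have := Nat.count_le (p := fun k => P (a + k)) (n := b)
  omega

noncomputable def S1equiv (n N : ℕ) (P : ℕ → Prop) [DecidablePred P] (hP : ∀ i, P i → i + 1 < n) :
    S1 n N P ≃ (Fin n ↪o Fin (N + n - Nat.count P n)) where
  toFun g := OrderEmbedding.ofStrictMono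
    (fun i => ⟨(g.1 i).val + (i.val - Nat.count P i.val), by
      have h1 := (g.1 i).isLt
      have h2 := i.isLt
      have h3 : Nat.count P n = Nat.count P (n - 1) := by
        obtain ⟨m, rfl⟩ : ∃ m, n = m + 1 := ⟨n - 1, by omega⟩
        have : ¬ P m := fun h => by have := hP m h; omega
        simp [Nat.count_succ, this]
      have h4 := count_lip P i.val (n - 1 - i.val)
      rw [show i.val + (n - 1 - i.val) = n - 1 by omega] at h4
      have h5 := Nat.count_le (p := P) (n := i.val)
      omega⟩) (by
      obtain _ | n := n
      · intro i; exact i.elim0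
      · rw [Fin.strictMono_iff_lt_succ]
        intro i
        have h1 := g.2 i.val (by omega)
        have h1a : (g.1 i.castSucc).val ≤ (g.1 i.succ).val := h1.1
        have h1b : P i.val → (g.1 i.castSucc).val < (g.1 i.succ).val := h1.2
        have h5 := Nat.count_le (p := P) (n := i.val)
        simp only [Fin.lt_def, Fin.val_castSucc, Fin.val_succ, Nat.count_succ]
        split_ifs with h
        · have := h1b h; omega
        · omega)
  invFun h := ⟨fun i => ⟨(h i).val - (i.val - Nat.count P i.val), by
      have h1 := sm_le h (n - 1 - i.val) i.val i.isLt (by omega)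
      have h2 := Nat.count_monotone P (i.isLt.le)
      have h5 := Nat.count_le (p := P) (n := i.val)
      simp only [Fin.eta] at h1
      omega⟩, by
      intro i hi
      have h1 : (h ⟨i, by omega⟩).val < (h ⟨i + 1, hi⟩).val :=
        h.strictMono (show (⟨i, by omega⟩ : Fin n) < ⟨i + 1, hi⟩ by simp)
      have h2 := sm_ge h i (by omega)
      have h5 := Nat.count_le (p := P) (n := i)
      simp only [Fin.le_def, Fin.lt_def, Nat.count_succ]
      split_ifs with hp
      · constructor
        · omega
        · intro _; omega
      · refine ⟨by omega, fun h => absurd h hp⟩⟩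
  left_inv g := by
    apply Subtype.ext
    funext i
    apply Fin.ext
    simp
  right_inv h := by
    ext i
    have h2 := sm_ge h i.val i.isLt
    simp only [Fin.eta] at h2
    simp
    omega

lemma card_S1 (n N : ℕ) (P : ℕ → Prop) [DecidablePred P] (hP : ∀ i, P i → i + 1 < n) :
    Nat.card (S1 n N P) = (N + n - Nat.count P n).choose n := by
  rw [Nat.card_congr (S1equiv n N P hP), Nat.card_congr (Set.powersetCard.ofFinEmbEquiv)]
  rw [Set.powersetCard.card]
  simp

def isD {n : ℕ} (σ : Equiv.Perm (Fin n)) (i : ℕ) : Prop :=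
  ∃ h : i + 1 < n, σ ⟨i + 1, h⟩ < σ ⟨i, by omega⟩

open Classical in
lemma des_eq {n : ℕ} (σ : Equiv.Perm (Fin n)) : des σ = Nat.count (isD σ) n := by
  have e : Nat.count (isD σ) n = Nat.card {k // k < n ∧ isD σ k} := by
    rw [Nat.count_eq_card_filter_range, ← Fintype.card_coe, ← Nat.card_eq_fintype_card]
    exact Nat.card_congr (Equiv.subtypeEquivRight (by simp))
  rw [e]
  unfold des
  exact Nat.card_congr
    { toFun := fun i => ⟨i.1.1, i.1.2, i.2⟩
      invFun := fun i => ⟨⟨i.1, i.2.1⟩, i.2.2⟩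
      left_inv := fun i => rfl
      right_inv := fun i => rfl }

lemma sort_iff {n N : ℕ} (σ : Equiv.Perm (Fin n)) (f : Fin n → Fin (N + 1)) :
    Tuple.sort f = σ ↔ ∀ (i : ℕ) (h : i + 1 < n),
    (f ∘ σ) ⟨i, by omega⟩ ≤ (f ∘ σ) ⟨i + 1, h⟩ ∧
      (isD σ i → (f ∘ σ) ⟨i, by omega⟩ < (f ∘ σ) ⟨i + 1, h⟩) := by
  rw [eq_comm, Tuple.eq_sort_iff]
  constructor
  · rintro ⟨hm, hs⟩ i h
    have hle : (f ∘ σ) ⟨i, by omega⟩ ≤ (f ∘ σ) ⟨i + 1, h⟩ := hm (by simp)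
    refine ⟨hle, fun hd => lt_of_le_of_ne hle fun he => ?_⟩
    obtain ⟨_, hd⟩ := hd
    exact absurd (hs _ _ (by simp) he) (not_lt.2 hd.le)
  · intro H
    have hm : Monotone (f ∘ σ) := by
      obtain _ | n := n
      · intro i; exact i.elim0
      · rw [Fin.monotone_iff_le_succ]
        intro i
        exact (H i.val (by omega)).1
    refine ⟨hm, ?_⟩
    have key : ∀ (k i : ℕ) (h : i + k + 1 < n),
        (f ∘ σ) ⟨i, by omega⟩ = (f ∘ σ) ⟨i + k + 1, h⟩ → σ ⟨i, by omega⟩ < σ ⟨i + k + 1, h⟩ := by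
      have step : ∀ (i : ℕ) (h : i + 1 < n),
        (f ∘ σ) ⟨i, by omega⟩ = (f ∘ σ) ⟨i + 1, h⟩ → σ ⟨i, by omega⟩ < σ ⟨i + 1, h⟩ := by
        intro i h he
        by_contra hc
        have hne : σ ⟨i + 1, h⟩ ≠ σ ⟨i, by omega⟩ := by simp
        have hd : isD σ i := ⟨h, lt_of_le_of_ne (not_lt.1 hc) hne⟩
        exact absurd he ((H i h).2 hd).ne
      intro k
      induction k with
      | zero => intro i h he; exact step i h he
      | succ k ih =>
        intro i h he
        have h1 : (f ∘ σ) ⟨i, by omega⟩ ≤ (f ∘ σ) ⟨i + k + 1, by omega⟩ :=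
          hm (Fin.mk_le_mk.2 (by omega))
        have h2 : (f ∘ σ) ⟨i + k + 1, by omega⟩ ≤ (f ∘ σ) ⟨i + (k + 1) + 1, h⟩ :=
          hm (Fin.mk_le_mk.2 (by omega))
        have h3 := ih i (by omega) (le_antisymm h1 (by rw [he]; exact h2))
        have h4 := step (i + k + 1) (by omega) (le_antisymm h2 (he.symm.trans_le h1))
        exact h3.trans h4
    intro i j hij he
    have hij' : i.val < j.val := hij
    have := key (j.val - i.val - 1) i.val (by omega)
    have e : i.val + (j.val - i.val - 1) + 1 = j.val := by omega
    simp only [e] at this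
    exact this he

lemma worp (n N : ℕ) : (N + 1) ^ n = ∑ σ : Equiv.Perm (Fin n), (N + n - des σ).choose n := by
  classical
  have h1 : (N + 1) ^ n = (univ : Finset (Fin n → Fin (N + 1))).card := by simp
  rw [h1, Finset.card_eq_sum_card_fiberwise (f := fun f => Tuple.sort f) (t := univ) (by simp)]
  refine Finset.sum_congr rfl fun σ _ => ?_
  rw [des_eq, ← card_S1 n N (isD σ) (fun i h => h.1), ← Fintype.card_coe, ← Nat.card_eq_fintype_card]
  refine Nat.card_congr ((Equiv.arrowCongr σ.symm (Equiv.refl _)).subtypeEquiv ?_)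
  intro f
  simp only [mem_filter, mem_univ, true_and]
  exact sort_iff σ f

open PowerSeries in
lemma perm_gf (n : ℕ) : (∑ σ : Equiv.Perm (Fin n), (X : ℤ⟦X⟧) ^ des σ) =
    (1 - X) ^ (n + 1) * PowerSeries.mk (fun j => ((j : ℤ) + 1) ^ n) := by
  classical
  have hlt : ∀ σ : Equiv.Perm (Fin n), des σ < n ∨ n = 0 ∧ des σ = 0 := by
    intro σ
    rw [des_eq]
    obtain _ | m := n
    · simp
    · left
      have : ¬ isD σ m := fun h => by have := h.1; omega
      rw [Nat.count_succ]
      have := Nat.count_le (p := isD σ) (n := m)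
      simp [*]
  have h : (∑ σ : Equiv.Perm (Fin n), (X : ℤ⟦X⟧) ^ des σ) * (invOneSubPow ℤ (n + 1)).val =
      PowerSeries.mk (fun j => ((j : ℤ) + 1) ^ n) := by
    ext N
    rw [Finset.sum_mul, map_sum, coeff_mk]
    have := worp n N
    have h2 : ((N : ℤ) + 1) ^ n = ∑ σ : Equiv.Perm (Fin n), ((N + n - des σ).choose n : ℤ) := by
      exact_mod_cast this
    rw [h2]
    refine Finset.sum_congr rfl fun σ _ => ?_
    rw [coeff_X_pow_mul', invOneSubPow_val_succ_eq_mk_add_choose, coeff_mk]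
    have := hlt σ
    split_ifs with hd
    · congr 2; omega
    · rw [Nat.choose_eq_zero_of_lt (by omega)]; simp
  rw [← h, mul_left_comm, ← invOneSubPow_inv_eq_one_sub_pow]
  simp


abbrev Raw (n : ℕ) : Type := (m : ℕ) × (_ : Fin n → Fin (m + 1)) × (Fin m → ℕ)

def T (n : ℕ) : Finset (Raw n) :=
  (range (n + 1)).sigma fun m => (univ : Finset (Fin n → Fin (m + 1))).sigma fun α =>
    Fintype.piFinset fun k : Fin m => Finset.Ico 1 (cn α k.succ)

open PowerSeries in
lemma coeff_Ctot (n j : ℕ) : PowerSeries.coeff j (Ctot (X : ℤ⟦X⟧) n 1) =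
    (((T n).filter fun x => ∑ k, x.2.2 k = j).card : ℤ) := by
  have : Ctot (X : ℤ⟦X⟧) n 1 = ∑ x ∈ T n, X ^ (∑ k, x.2.2 k) := by
    unfold Ctot T
    rw [Finset.sum_sigma]
    refine Finset.sum_congr rfl fun m _ => ?_
    rw [Finset.sum_sigma]
    unfold Cm
    refine Finset.sum_congr rfl fun α _ => ?_
    unfold w
    rw [Finset.prod_univ_sum]
    simp [Finset.prod_pow_eq_pow_sum]
  rw [this, map_sum]
  simp only [coeff_X_pow]
  rw [Finset.sum_boole]
  congr 2
  ext x
  simp [eq_comm]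

def Phi {n : ℕ} (x : Raw n) : (Fin n → ℕ) × (ℕ → ℕ) :=
  (fun i => (x.2.1 i).val, fun k => if h : 1 ≤ k ∧ k ≤ x.1 then x.2.2 ⟨k - 1, by omega⟩ else 0)

lemma occ_Phi {n : ℕ} (x : Raw n) (k : Fin x.1) : occ (Phi x).1 (k.val + 1) = cn x.2.1 k.succ := by
  unfold occ cn
  congr 1
  ext i
  rw [Finset.mem_filter, Finset.mem_filter]
  simp [Phi, Fin.ext_iff]

lemma mem_T {n : ℕ} (x : Raw n) : x ∈ T n ↔
    x.1 ≤ n ∧ ∀ k : Fin x.1, 1 ≤ x.2.2 k ∧ x.2.2 k < cn x.2.1 k.succ := by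
  simp [T]

lemma exists_of_occ {n : ℕ} (a : Fin n → ℕ) (k : ℕ) (h : 0 < occ a k) : ∃ i, a i = k := by
  unfold occ at h
  rw [Finset.card_pos] at h
  obtain ⟨i, hi⟩ := h
  exact ⟨i, by simpa using hi⟩

lemma maxVal_Phi {n : ℕ} (x : Raw n) (hx : x ∈ T n) : maxVal (Phi x).1 = x.1 := by
  rw [mem_T] at hx
  apply le_antisymm
  · apply Finset.sup_le
    intro i _
    exact Nat.lt_succ_iff.1 (x.2.1 i).isLt
  · rcases Nat.eq_zero_or_pos x.1 with h | h
    · omega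
    · have h1 := hx.2 ⟨x.1 - 1, by omega⟩
      rw [← occ_Phi] at h1
      simp only at h1
      obtain ⟨i, hi⟩ := exists_of_occ (Phi x).1 _ (by omega : 0 < occ (Phi x).1 (x.1 - 1 + 1))
      have : (Phi x).1 i ≤ maxVal (Phi x).1 := Finset.le_sup (mem_univ i)
      omega

lemma codeIndex_eq {n : ℕ} (a : Fin n → ℕ) (f : ℕ → ℕ) :
    codeIndex a f = ∑ k : Fin (maxVal a), f (k.val + 1) := by
  unfold codeIndex
  rw [← Finset.sum_range (fun k => f (k + 1)),
    show Finset.Icc 1 (maxVal a) = Finset.Ico 1 (maxVal a + 1) by ext; simp,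
    Finset.sum_Ico_eq_sum_range]
  simp [add_comm]

lemma isCode_Phi {n : ℕ} (x : Raw n) (hx : x ∈ T n) : IsCode (Phi x).1 (Phi x).2 := by
  have hm := maxVal_Phi x hx
  rw [mem_T] at hx
  unfold IsCode
  rw [hm]
  have key : ∀ k, 1 ≤ k → k ≤ x.1 → 1 ≤ (Phi x).2 k ∧ (Phi x).2 k < occ (Phi x).1 k := by
    intro k h1 h2
    have h3 := hx.2 ⟨k - 1, by omega⟩
    rw [← occ_Phi] at h3
    have e : k - 1 + 1 = k := by omega
    simp only [e] at h3
    have : (Phi x).2 k = x.2.2 ⟨k - 1, by omega⟩ := by simp [Phi, h1, h2]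
    rw [this]; exact h3
  refine ⟨fun k h1 h2 => ?_, fun k h1 h2 => ?_, fun k h => ?_⟩
  · have := key k h1 h2; omega
  · have := key k h1 h2; omega
  · simp only [Phi]
    rw [dif_neg]
    omega

lemma index_Phi {n : ℕ} (x : Raw n) (hx : x ∈ T n) :
    codeIndex (Phi x).1 (Phi x).2 = ∑ k, x.2.2 k := by
  rw [codeIndex_eq, maxVal_Phi x hx]
  refine Finset.sum_congr rfl fun k _ => ?_
  simp [Phi, Nat.succ_le_iff]

lemma Phi_inj {n : ℕ} (x y : Raw n) (hx : x ∈ T n) (hy : y ∈ T n) (h : Phi x = Phi y) : x = y := by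
  have hm : x.1 = y.1 := by rw [← maxVal_Phi x hx, ← maxVal_Phi y hy, h]
  obtain ⟨m, α, g⟩ := x
  obtain ⟨m', α', g'⟩ := y
  simp only at hm
  subst hm
  have h1 := congrArg Prod.fst h
  have h2 := congrArg Prod.snd h
  have e1 : α = α' := by
    funext i
    exact Fin.ext (congrFun h1 i)
  have e2 : g = g' := by
    funext k
    have := congrFun h2 (k.val + 1)
    simpa [Phi, Nat.succ_le_iff] using this
  rw [e1, e2]

lemma Phi_surj {n : ℕ} (a : Fin n → ℕ) (f : ℕ → ℕ) (h : IsCode a f) :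
    ∃ x ∈ T n, Phi x = (a, f) := by
  obtain ⟨h1, h2, h3⟩ := h
  have hP : Phi (⟨maxVal a, fun i => ⟨a i, Nat.lt_succ_iff.2 (Finset.le_sup (mem_univ i))⟩,
    fun k => f (k.val + 1)⟩ : Raw n) = (a, f) := by
    unfold Phi
    refine Prod.ext rfl ?_
    funext k
    by_cases hk : 1 ≤ k ∧ k ≤ maxVal a
    · simp [hk]
    · simp only [hk, dite_false]
      exact (h3 k (by omega)).symm
  refine ⟨_, ?_, hP⟩
  rw [mem_T]
  constructor
  · have : ∀ k : Fin (maxVal a), ∃ i, a i = k.val + 1 := fun k =>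
      exists_of_occ a _ (by have := h1 (k.val + 1) (by omega) (by omega); omega)
    choose g hg using this
    have hinj : Function.Injective g := by
      intro p q hpq
      have := hg p
      rw [hpq, hg q] at this
      exact Fin.ext (by omega)
    simpa using Fintype.card_le_of_injective g hinj
  · intro k
    rw [← occ_Phi, hP]
    have := h1 (k.val + 1) (by omega) (by have := k.isLt; simp only at this; omega)
    have := h2 (k.val + 1) (by omega) (by have := k.isLt; simp only at this; omega)
    simp only
    omega

lemma card_codes (n j : ℕ) :
    Nat.card {p : (Fin n → ℕ) × (ℕ → ℕ) // IsCode p.1 p.2 ∧ codeIndex p.1 p.2 = j} =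
      ((T n).filter fun x => ∑ k, x.2.2 k = j).card := by
  rw [← Fintype.card_coe, ← Nat.card_eq_fintype_card]
  symm
  refine Nat.card_congr (Equiv.ofBijective
    (fun x => ⟨Phi x.1, isCode_Phi x.1 (mem_filter.1 x.2).1,
      (index_Phi x.1 (mem_filter.1 x.2).1).trans (mem_filter.1 x.2).2⟩) ⟨?_, ?_⟩)
  · intro x y hxy
    exact Subtype.ext (Phi_inj x.1 y.1 (mem_filter.1 x.2).1 (mem_filter.1 y.2).1
      (congrArg Subtype.val hxy))
  · rintro ⟨⟨a, f⟩, hc, hi⟩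
    obtain ⟨x, hx, hP⟩ := Phi_surj a f hc
    refine ⟨⟨x, mem_filter.2 ⟨hx, ?_⟩⟩, Subtype.ext hP⟩
    rw [← index_Phi x hx, hP]
    exact hi

end Stem

theorem stmt2 (n j : ℕ) :
    Nat.card {p : (Fin n → ℕ) × (ℕ → ℕ) // IsCode p.1 p.2 ∧ codeIndex p.1 p.2 = j} =
      Nat.card {σ : Equiv.Perm (Fin n) // des σ = j} := by
  rw [Stem.card_codes]
  have h := congrArg (PowerSeries.coeff j) ((Stem.Ctot_eq n).trans (Stem.perm_gf n).symm)
  rw [Stem.coeff_Ctot, map_sum] at h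
  simp only [PowerSeries.coeff_X_pow] at h
  rw [Finset.sum_boole] at h
  have h2 := Nat.cast_injective h
  rw [h2, Nat.card_eq_fintype_card, Fintype.card_subtype]
  congr 1
  ext σ
  simp [eq_comm]
end

section
/- The number of elements of FY(B_n) with Σ a_i = j equals the Eulerian number A(n,j); equivalently, Σ_{chains with exponents} t^{Σ a_i} = A_n(t), the n-th Eulerian polynomial. -/
open Finset

/-- the previous set `F (i-1)` in a chain, with `F (-1) = ∅` -/
def prevSet {n k : ℕ} (F : Fin k → Finset (Fin n)) (i : Fin k) : Finset (Fin n) :=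
  if h : 0 < (i : ℕ) then F ⟨(i : ℕ) - 1, Nat.lt_of_le_of_lt (Nat.sub_le _ _) i.isLt⟩ else ∅

/-- Feichtner--Yuzvinsky basis data for the Chow ring of the Boolean matroid:
a strictly increasing chain `∅ = F₀ ⊊ F₁ ⊊ ⋯ ⊊ F_k ⊆ [n]` together with exponents
`1 ≤ aᵢ ≤ |Fᵢ| - |Fᵢ₋₁| - 1`. -/
def IsFY {n : ℕ} (p : Σ k : ℕ, (Fin k → Finset (Fin n)) × (Fin k → ℕ)) : Prop :=
  StrictMono p.2.1 ∧
  ∀ i : Fin p.1, 1 ≤ p.2.2 i ∧ p.2.2 i + (prevSet p.2.1 i).card < (p.2.1 i).card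

/-- total degree `Σ aᵢ` of the monomial data -/
def FYdeg {n : ℕ} (p : Σ k : ℕ, (Fin k → Finset (Fin n)) × (Fin k → ℕ)) : ℕ :=
  ∑ i, p.2.2 i

/-- the set `FY(B_n)` -/
def FYBn (n : ℕ) := {p : Σ k : ℕ, (Fin k → Finset (Fin n)) × (Fin k → ℕ) // IsFY p}

/-- the action of a permutation of `[n]` on monomial data, replacing each `Fᵢ` by its image -/
def permFY {n : ℕ} (σ : Equiv.Perm (Fin n))
    (p : Σ k : ℕ, (Fin k → Finset (Fin n)) × (Fin k → ℕ)) :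
    Σ k : ℕ, (Fin k → Finset (Fin n)) × (Fin k → ℕ) :=
  ⟨p.1, fun i => (p.2.1 i).image σ, p.2.2⟩

/-! ### The Eulerian polynomials through a transfer recursion -/

open Polynomial in
/-- generating polynomial of words of length `n` after a letter with `k` smaller letters left -/
noncomputable def eTr : ℕ → ℕ → ℚ[X]
  | 0, _ => 1
  | n + 1, k => ∑ i ∈ range (n + 1), (if i < k then X else 1) * eTr n i

open Polynomial in
lemma eTr_step (n k : ℕ) (hk : k ≤ n) :
    eTr (n + 1) (k + 1) = eTr (n + 1) k + (X - 1) * eTr n k := by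
  simp only [eTr]
  rw [← sub_eq_iff_eq_add', ← Finset.sum_sub_distrib]
  rw [Finset.sum_eq_single k]
  · simp; ring
  · intro i _ hik
    have : (i < k + 1) ↔ (i < k) := by omega
    simp [this]
  · intro h; simp at h; omega

open Polynomial in
lemma eTr_formula (k : ℕ) : ∀ n, k ≤ n →
    eTr n k = ∑ m ∈ range (k + 1), (k.choose m : ℚ[X]) * (X - 1) ^ m * eTr (n - m) 0 := by
  induction k with
  | zero => intro n _; simp
  | succ k ih =>
    intro n hn
    obtain ⟨n, rfl⟩ : ∃ n', n = n' + 1 := ⟨n - 1, by omega⟩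
    rw [eTr_step n k (by omega), ih (n + 1) (by omega), ih n (by omega)]
    rw [Finset.sum_range_succ' _ (k + 1)]
    simp only [Nat.choose_succ_succ, Nat.cast_add, add_mul, Finset.sum_add_distrib]
    rw [Finset.mul_sum]
    have h1 : ∑ m ∈ range (k + 1), (k.choose m : ℚ[X]) * (X - 1) ^ m * eTr (n + 1 - m) 0
        = ∑ m ∈ range (k + 1), (k.choose (m + 1) : ℚ[X]) * (X - 1) ^ (m + 1)
            * eTr (n + 1 - (m + 1)) 0 + eTr (n + 1) 0 := by
      have := Finset.sum_range_succ'
        (fun m => (k.choose m : ℚ[X]) * (X - 1) ^ m * eTr (n + 1 - m) 0) (k + 1)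
      rw [Finset.sum_range_succ] at this
      simpa using this
    rw [h1]
    have h2 : ∀ m, n + 1 - (m + 1) = n - m := by intro m; omega
    simp only [h2]
    have h3 : ∀ m, (X - 1) * ((k.choose m : ℚ[X]) * (X - 1) ^ m * eTr (n - m) 0)
       = (k.choose m : ℚ[X]) * (X - 1) ^ (m + 1) * eTr (n - m) 0 := by intro m; ring
    simp only [h3]
    simp
    ring

open Polynomial in
lemma eTr_full (n : ℕ) : eTr (n + 1) (n + 1) = X * eTr (n + 1) 0 := by
  simp only [eTr, Finset.mul_sum]
  apply Finset.sum_congr rfl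
  intro i hi
  simp at hi
  simp [hi]

open Polynomial in
lemma eTr_R1 (n : ℕ) :
    ∑ m ∈ range (n + 1), (n.choose m : ℚ[X]) * (X - 1) ^ m * eTr (n - m) 0
      = X * eTr n 0 + if n = 0 then 1 - X else 0 := by
  cases n with
  | zero => simp [eTr]
  | succ n => rw [← eTr_formula (n + 1) (n + 1) le_rfl, eTr_full]; simp

open Polynomial in
/-- exponential generating function -/
noncomputable def eGF (A : ℕ → ℚ[X]) : PowerSeries ℚ[X] :=
  PowerSeries.mk fun n => C ((n.factorial : ℚ)⁻¹) * A n

open Polynomial in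
lemma coeff_eGF_mul (A : ℕ → ℚ[X]) (s : ℚ[X]) (n : ℕ) :
    PowerSeries.coeff n (PowerSeries.rescale s (PowerSeries.exp ℚ[X]) * eGF A) =
      C ((n.factorial : ℚ)⁻¹) *
        ∑ m ∈ range (n + 1), (n.choose m : ℚ[X]) * s ^ m * A (n - m) := by
  rw [PowerSeries.coeff_mul, Finset.Nat.sum_antidiagonal_eq_sum_range_succ_mk, Finset.mul_sum]
  apply Finset.sum_congr rfl
  intro m hm
  have hm' : m ≤ n := by simp at hm; omega
  simp only [PowerSeries.coeff_rescale, PowerSeries.coeff_exp, eGF, PowerSeries.coeff_mk]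
  have h : (C ((n.factorial : ℚ)⁻¹) : ℚ[X]) * (n.choose m : ℚ[X]) =
      C (1 / (m.factorial : ℚ)) * C (((n - m).factorial : ℚ)⁻¹) := by
    rw [← Polynomial.C_eq_natCast, ← C_mul, ← C_mul]
    congr 1
    rw [Nat.cast_choose ℚ hm']
    have := Nat.factorial_ne_zero n
    field_simp
  calc _ = s ^ m * A (n - m) * (C (1 / (m.factorial : ℚ)) * C (((n - m).factorial : ℚ)⁻¹)) := by
        rw [Polynomial.algebraMap_eq]; ring
    _ = _ := by rw [← h]; ring

open Polynomial in
lemma eTr_R2 (n : ℕ) :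
    ∑ m ∈ range (n + 1), (n.choose m : ℚ[X]) * X ^ m * eTr (n - m) 0
      = X * (∑ m ∈ range (n + 1), (n.choose m : ℚ[X]) * 1 ^ m * eTr (n - m) 0) + (1 - X) := by
  have h1 : PowerSeries.rescale (X - 1 : ℚ[X]) (PowerSeries.exp ℚ[X]) * eGF (fun n => eTr n 0)
      = PowerSeries.C (X : ℚ[X]) * eGF (fun n => eTr n 0) + PowerSeries.C (1 - X : ℚ[X]) := by
    ext1 n
    rw [coeff_eGF_mul, eTr_R1]
    simp only [map_add, PowerSeries.coeff_C_mul, PowerSeries.coeff_C, eGF, PowerSeries.coeff_mk]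
    split_ifs with h
    · subst h; simp
    · ring
  have h2 : PowerSeries.rescale (X : ℚ[X]) (PowerSeries.exp ℚ[X]) * eGF (fun n => eTr n 0)
      = PowerSeries.C (X : ℚ[X]) * (PowerSeries.rescale (1 : ℚ[X]) (PowerSeries.exp ℚ[X])
          * eGF (fun n => eTr n 0)) +
        PowerSeries.C (1 - X : ℚ[X]) * PowerSeries.rescale (1 : ℚ[X]) (PowerSeries.exp ℚ[X]) := by
    have h3 := PowerSeries.exp_mul_exp_eq_exp_add (A := ℚ[X]) (X - 1) 1
    rw [sub_add_cancel] at h3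
    rw [← h3, mul_right_comm, h1]
    ring
  have h4 := congrArg (PowerSeries.coeff n) h2
  rw [map_add, PowerSeries.coeff_C_mul, PowerSeries.coeff_C_mul, coeff_eGF_mul,
    coeff_eGF_mul] at h4
  simp only [PowerSeries.coeff_rescale, PowerSeries.coeff_exp, one_pow, one_mul,
    Polynomial.algebraMap_eq, one_div] at h4
  have h5 : (C ((n.factorial : ℚ)⁻¹) : ℚ[X]) ≠ 0 := by
    simp [Nat.factorial_ne_zero]
  apply mul_left_cancel₀ h5
  rw [h4]
  simp only [one_pow]
  ring

open Polynomial in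
lemma eTr_R3 (n : ℕ) :
    eTr n 0 = 1 + ∑ m ∈ range (n + 1),
      n.choose m • ((∑ a ∈ Ico 1 m, X ^ a) * eTr (n - m) 0) := by
  have h := eTr_R2 n
  rw [Finset.mul_sum, ← sub_eq_iff_eq_add', ← Finset.sum_sub_distrib] at h
  rw [Finset.sum_range_succ'] at h ⊢
  have hx : (X - 1 : ℚ[X]) ≠ 0 := by
    simpa using Polynomial.X_sub_C_ne_zero (1 : ℚ)
  apply mul_left_cancel₀ hx
  have key : ∀ m, (X - 1 : ℚ[X]) * (n.choose (m + 1) •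
      ((∑ a ∈ Ico 1 (m + 1), X ^ a) * eTr (n - (m + 1)) 0)) =
      (n.choose (m + 1) : ℚ[X]) * X ^ (m + 1) * eTr (n - (m + 1)) 0 -
        X * ((n.choose (m + 1) : ℚ[X]) * 1 ^ (m + 1) * eTr (n - (m + 1)) 0) := by
    intro m
    have hg : (X - 1 : ℚ[X]) * (∑ a ∈ Ico 1 (m + 1), X ^ a) = X ^ (m + 1) - X := by
      rw [mul_comm, geom_sum_Ico_mul X (by omega : 1 ≤ m + 1)]; simp
    rw [nsmul_eq_mul]
    calc _ = (n.choose (m + 1) : ℚ[X]) * ((X - 1 : ℚ[X]) * (∑ a ∈ Ico 1 (m + 1), X ^ a))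
          * eTr (n - (m + 1)) 0 := by ring
      _ = _ := by rw [hg]; ring
  rw [mul_add, mul_add, Finset.mul_sum]
  simp only [key]
  simp at h ⊢
  linear_combination -h

/-! ### Words -/

section Words
variable {n : ℕ}

/-- descents of the word `a :: l` -/
def wdes : Fin n → List (Fin n) → ℕ
  | _, [] => 0
  | a, b :: l => (if b < a then 1 else 0) + wdes b l

/-- descents of a word -/
def wdes0 : List (Fin n) → ℕ
  | [] => 0
  | b :: l => wdes b l

/-- arrangements of a set -/
def arr : ℕ → Finset (Fin n) → Finset (List (Fin n))
  | 0, _ => {[]}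
  | f + 1, S => (S.sigma fun b => arr f (S.erase b)).image fun q => q.1 :: q.2

lemma mem_arr (f : ℕ) : ∀ (S : Finset (Fin n)) (l : List (Fin n)), #S = f →
    (l ∈ arr f S ↔ l.Nodup ∧ l.toFinset = S) := by
  induction f with
  | zero =>
    intro S l h
    rw [Finset.card_eq_zero] at h
    subst h
    simp only [arr, Finset.mem_singleton, List.toFinset_eq_empty_iff]
    constructor
    · rintro rfl; simp
    · exact fun h => h.2
  | succ f ih =>
    intro S l h
    simp only [arr, Finset.mem_image, Finset.mem_sigma, Sigma.exists]
    constructor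
    · rintro ⟨b, l', ⟨hb, hl⟩, rfl⟩
      rw [ih _ _ (by rw [Finset.card_erase_of_mem hb, h]; rfl)] at hl
      have hbl : b ∉ l' := by
        rw [← List.mem_toFinset, hl.2]; simp
      refine ⟨List.nodup_cons.2 ⟨hbl, hl.1⟩, ?_⟩
      rw [List.toFinset_cons, hl.2, Finset.insert_erase hb]
    · rintro ⟨hn, hl⟩
      cases l with
      | nil => simp at hl; subst hl; simp at h
      | cons b l' =>
        have hb : b ∈ S := by rw [← hl]; simp
        refine ⟨b, l', ⟨hb, ?_⟩, rfl⟩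
        rw [ih _ _ (by rw [Finset.card_erase_of_mem hb, h]; rfl)]
        rw [List.nodup_cons] at hn
        refine ⟨hn.2, ?_⟩
        rw [← hl, List.toFinset_cons, Finset.erase_insert]
        simpa using hn.1

lemma sum_rank {M : Type*} [AddCommMonoid M] (S : Finset (Fin n)) (g : ℕ → M) :
    ∑ b ∈ S, g #{c ∈ S | c < b} = ∑ i ∈ range #S, g i := by
  have hmono : ∀ a ∈ S, ∀ b ∈ S, a < b → #{c ∈ S | c < a} < #{c ∈ S | c < b} := by
    intro a ha b hb hab
    apply Finset.card_lt_card
    rw [Finset.ssubset_iff_of_subset]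
    · exact ⟨a, by simp [ha, hab], by simp⟩
    · intro c hc
      simp only [Finset.mem_filter] at hc ⊢
      exact ⟨hc.1, hc.2.trans hab⟩
  have hinj : Set.InjOn (fun b => #{c ∈ S | c < b}) (S : Set (Fin n)) := by
    intro a ha b hb hab
    rcases lt_trichotomy a b with h | h | h
    · exact absurd hab (hmono a ha b hb h).ne
    · exact h
    · exact absurd hab (hmono b hb a ha h).ne'
  have himg : S.image (fun b => #{c ∈ S | c < b}) = range #S := by
    apply Finset.eq_of_subset_of_card_le
    · intro i hi
      simp only [Finset.mem_image] at hi
      obtain ⟨b, hb, rfl⟩ := hi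
      rw [Finset.mem_range]
      apply Finset.card_lt_card
      rw [Finset.ssubset_iff_of_subset (Finset.filter_subset _ _)]
      exact ⟨b, hb, by simp⟩
    · rw [Finset.card_image_of_injOn hinj]; simp
  rw [← himg, Finset.sum_image hinj]

open Polynomial in
lemma sum_arr_succ (f : ℕ) (S : Finset (Fin n)) (w : List (Fin n) → ℚ[X]) :
    ∑ l ∈ arr (f + 1) S, w l = ∑ b ∈ S, ∑ l ∈ arr f (S.erase b), w (b :: l) := by
  simp only [arr]
  rw [Finset.sum_image, Finset.sum_sigma]
  rintro ⟨a, l⟩ _ ⟨b, l'⟩ _ h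
  simp at h
  obtain ⟨rfl, rfl⟩ := h
  rfl

open Polynomial in
lemma sum_wdes (f : ℕ) : ∀ (S : Finset (Fin n)) (a : Fin n), #S = f → a ∉ S →
    ∑ l ∈ arr f S, (X : ℚ[X]) ^ wdes a l = eTr f #{c ∈ S | c < a} := by
  induction f with
  | zero => intro S a _ _; simp [arr, wdes, eTr]
  | succ f ih =>
    intro S a hS ha
    rw [sum_arr_succ]
    simp only [eTr]
    rw [← hS, ← sum_rank S
      (fun i => (if i < #{c ∈ S | c < a} then (X : ℚ[X]) else 1) * eTr f i)]
    apply Finset.sum_congr rfl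
    intro b hb
    have hr : {c ∈ S.erase b | c < b} = {c ∈ S | c < b} := by
      ext c
      simp only [Finset.mem_filter, Finset.mem_erase]
      constructor
      · rintro ⟨⟨_, h⟩, h'⟩; exact ⟨h, h'⟩
      · rintro ⟨h, h'⟩; exact ⟨⟨h'.ne, h⟩, h'⟩
    have hi := ih (S.erase b) b (by rw [Finset.card_erase_of_mem hb, hS]; rfl) (by simp)
    rw [hr] at hi
    have hlt : #{c ∈ S | c < b} < #{c ∈ S | c < a} ↔ b < a := by
      constructor
      · intro h
        by_contra hba
        push Not at hba
        apply absurd h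
        push Not
        apply Finset.card_le_card
        intro c hc
        simp only [Finset.mem_filter] at hc ⊢
        exact ⟨hc.1, hc.2.trans_le hba⟩
      · intro h
        apply Finset.card_lt_card
        rw [Finset.ssubset_iff_of_subset]
        · exact ⟨b, by simp [hb, h], by simp⟩
        · intro c hc
          simp only [Finset.mem_filter] at hc ⊢
          exact ⟨hc.1, hc.2.trans h⟩
    rw [← hi, Finset.mul_sum]
    apply Finset.sum_congr rfl
    intro l _
    rw [wdes, pow_add]
    simp only [hlt]
    split_ifs <;> simp

open Polynomial in
lemma sum_wdes0 (S : Finset (Fin n)) :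
    ∑ l ∈ arr #S S, (X : ℚ[X]) ^ wdes0 l = eTr #S 0 := by
  obtain ⟨f, hf⟩ : ∃ f, #S = f := ⟨_, rfl⟩
  rw [hf]
  cases f with
  | zero => simp [arr, wdes0, eTr]
  | succ f =>
    rw [sum_arr_succ]
    simp only [eTr, wdes0]
    rw [← hf, ← sum_rank S (fun i => (if i < 0 then (X : ℚ[X]) else 1) * eTr f i)]
    apply Finset.sum_congr rfl
    intro b hb
    rw [sum_wdes f _ _ (by rw [Finset.card_erase_of_mem hb, hf]; rfl) (by simp)]
    have hr : {c ∈ S.erase b | c < b} = {c ∈ S | c < b} := by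
      ext c
      simp only [Finset.mem_filter, Finset.mem_erase]
      constructor
      · rintro ⟨⟨_, h⟩, h'⟩; exact ⟨h, h'⟩
      · rintro ⟨h, h'⟩; exact ⟨⟨h'.ne, h⟩, h'⟩
    rw [hr]
    simp

lemma wdes0_ofFn (k : ℕ) : ∀ (g : Fin k → Fin n),
    wdes0 (List.ofFn g) =
      ∑ i : Fin k, if ∃ h : (i : ℕ) + 1 < k, g ⟨(i : ℕ) + 1, h⟩ < g i then 1 else 0 := by
  induction k with
  | zero => intro g; simp [wdes0]
  | succ k ih =>
    intro g
    rw [Fin.sum_univ_succ, List.ofFn_succ, wdes0]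
    have h2 := ih (fun i => g i.succ)
    have h3 : ∀ i : Fin k, (∃ h : ((i.succ : Fin (k + 1)) : ℕ) + 1 < k + 1,
        g ⟨((i.succ : Fin (k + 1)) : ℕ) + 1, h⟩ < g i.succ) ↔
        (∃ h : (i : ℕ) + 1 < k, g (Fin.succ ⟨(i : ℕ) + 1, h⟩) < g i.succ) := by
      intro i
      constructor
      · rintro ⟨h, h'⟩
        exact ⟨by simpa using h, h'⟩
      · rintro ⟨h, h'⟩
        exact ⟨by simpa using h, h'⟩
    simp only [h3]
    rw [← h2]
    cases k with
    | zero =>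
      rw [if_neg]
      · rfl
      · rintro ⟨h, _⟩
        exact absurd h (by decide)
    | succ k =>
      rw [List.ofFn_succ, wdes, wdes0]
      congr 1
      apply if_congr _ rfl rfl
      constructor
      · intro h; exact ⟨by simp, h⟩
      · rintro ⟨_, h⟩; exact h

lemma des_eq (σ : Equiv.Perm (Fin n)) : des σ = wdes0 (List.ofFn σ) := by
  classical
  rw [wdes0_ofFn, des, Nat.card_eq_fintype_card, Fintype.card_subtype, Finset.card_filter]

open Polynomial in
lemma coeff_sum_pow {α : Type*} (s : Finset α) (d : α → ℕ) (j : ℕ) :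
    (∑ l ∈ s, (X : ℚ[X]) ^ d l).coeff j = (Nat.card {l : α // l ∈ s ∧ d l = j} : ℚ) := by
  classical
  have : Nat.card {l : α // l ∈ s ∧ d l = j} = #{l ∈ s | d l = j} := by
    rw [Nat.subtype_card]
    intro x; simp
  rw [this, Polynomial.finsetSum_coeff]
  simp only [Polynomial.coeff_X_pow]
  rw [Finset.card_filter]
  push_cast
  apply Finset.sum_congr rfl
  intro l _
  simp only [eq_comm]

lemma card_perm (j : ℕ) : Nat.card {σ : Equiv.Perm (Fin n) // des σ = j} =
    Nat.card {l : List (Fin n) // l ∈ arr n univ ∧ wdes0 l = j} := by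
  apply Nat.card_congr
  refine Equiv.ofBijective (fun σ => ⟨List.ofFn σ.1, ?_, ?_⟩) ⟨?_, ?_⟩
  · rw [mem_arr _ _ _ (by simp)]
    refine ⟨List.nodup_ofFn.2 σ.1.injective, ?_⟩
    ext x
    simp only [List.mem_toFinset, List.mem_ofFn, Finset.mem_univ, iff_true]
    exact σ.1.surjective x
  · rw [← des_eq]; exact σ.2
  · rintro ⟨σ, _⟩ ⟨τ, _⟩ h
    simp only [Subtype.mk.injEq] at h ⊢
    exact DFunLike.coe_injective (List.ofFn_injective h)
  · rintro ⟨l, hl, hd⟩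
    rw [mem_arr _ _ _ (by simp)] at hl
    have hlen : l.length = n := by
      rw [← List.toFinset_card_of_nodup hl.1, hl.2]; simp
    let g : Fin n → Fin n := fun i => l.get (i.cast hlen.symm)
    have hg : List.ofFn g = l := by
      apply List.ext_get
      · simp [hlen]
      · intro i h1 h2; simp [g]
    have hgi : Function.Injective g := by
      rw [← List.nodup_ofFn, hg]; exact hl.1
    have hgb : Function.Bijective g := Finite.injective_iff_bijective.1 hgi
    refine ⟨⟨Equiv.ofBijective g hgb, ?_⟩, ?_⟩
    · rw [des_eq]; simpa [hg] using hd
    · simp [hg]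

/-! ### Chains -/

/-- valid chains above `G` -/
def Vd : Finset (Fin n) → List (Finset (Fin n) × ℕ) → Prop
  | _, [] => True
  | G, p :: l => (G ⊂ p.1 ∧ 1 ≤ p.2 ∧ p.2 + #G < #p.1) ∧ Vd p.1 l

/-- degree -/
def ldeg (l : List (Finset (Fin n) × ℕ)) : ℕ := (l.map Prod.snd).sum

/-- the finite set of chains above `G` -/
def chs : ℕ → Finset (Fin n) → Finset (List (Finset (Fin n) × ℕ))
  | 0, _ => {[]}
  | f + 1, G => insert [] ((((Gᶜ).powerset.sigma fun T => Ico 1 #T).sigma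
      fun p => chs f (G ∪ p.1)).image fun q => (G ∪ q.1.1, q.1.2) :: q.2)

lemma mem_chs (f : ℕ) : ∀ (G : Finset (Fin n)) (l), n - #G ≤ f →
    (l ∈ chs f G ↔ Vd G l) := by
  induction f with
  | zero =>
    intro G l h
    simp only [chs, Finset.mem_singleton]
    cases l with
    | nil => simp [Vd]
    | cons p l =>
      simp only [Vd, reduceCtorEq, false_iff]
      rintro ⟨⟨_, _, h3⟩, _⟩
      have := Finset.card_le_univ p.1
      simp at this
      omega
  | succ f ih =>
    intro G l h
    simp only [chs, Finset.mem_insert, Finset.mem_image, Finset.mem_sigma, Sigma.exists,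
      Finset.mem_powerset, Finset.mem_Ico]
    cases l with
    | nil => simp [Vd]
    | cons p l =>
      simp only [Vd, reduceCtorEq, false_or]
      constructor
      · rintro ⟨T, a, l', ⟨⟨hT, ha1, ha2⟩, hl⟩, he⟩
        simp only [List.cons.injEq] at he
        obtain ⟨rfl, rfl⟩ := he
        have hd : Disjoint G T := by
          rw [Finset.disjoint_left]
          intro x hx hxT
          exact (Finset.mem_compl.1 (hT hxT)) hx
        have hc := Finset.card_union_of_disjoint hd
        rw [ih _ _ (by omega)] at hl
        refine ⟨⟨?_, ha1, by simp only; omega⟩, hl⟩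
        refine Finset.ssubset_iff_subset_ne.2 ⟨Finset.subset_union_left, fun h => ?_⟩
        have := congrArg Finset.card h
        simp only at this
        omega
      · rintro ⟨⟨h1, h2, h3⟩, h4⟩
        have hu : G ∪ (p.1 \ G) = p.1 := Finset.union_sdiff_of_subset h1.1
        have hc := Finset.card_sdiff_add_card_eq_card h1.1
        refine ⟨p.1 \ G, p.2, l, ⟨⟨?_, h2, by omega⟩, ?_⟩, ?_⟩
        · intro x hx; simp at hx ⊢; exact hx.2
        · simp only [hu]
          rw [ih _ _ (by omega)]; exact h4
        · simp only [hu]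

open Polynomial in
lemma sum_chs (f : ℕ) : ∀ (G : Finset (Fin n)), n - #G ≤ f →
    ∑ l ∈ chs f G, (X : ℚ[X]) ^ ldeg l = eTr (n - #G) 0 := by
  induction f with
  | zero =>
    intro G h
    have : n - #G = 0 := by omega
    simp [this, chs, ldeg, eTr]
  | succ f ih =>
    intro G h
    have hcard : #Gᶜ = n - #G := by simp [Finset.card_compl]
    rw [eTr_R3, ← hcard]
    rw [← Finset.sum_powerset_apply_card
      (fun m => (∑ a ∈ Ico 1 m, (X : ℚ[X]) ^ a) * eTr (#Gᶜ - m) 0) (x := Gᶜ)]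
    simp only [chs]
    rw [Finset.sum_insert (by simp)]
    rw [Finset.sum_image, Finset.sum_sigma, Finset.sum_sigma]
    · congr 1
      apply Finset.sum_congr rfl
      intro T hT
      rw [Finset.mem_powerset] at hT
      have hd : Disjoint G T := by
        rw [Finset.disjoint_left]
        intro x hx hxT
        exact (Finset.mem_compl.1 (hT hxT)) hx
      have hc := Finset.card_union_of_disjoint hd
      rw [Finset.sum_mul]
      apply Finset.sum_congr rfl
      intro a ha
      rw [Finset.mem_Ico] at ha
      have h1 := ih (G ∪ T) (by omega)
      have h2 : n - #(G ∪ T) = #Gᶜ - #T := by omega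
      rw [← h2, ← h1, Finset.mul_sum]
      apply Finset.sum_congr rfl
      intro l _
      simp [ldeg, pow_add]
    · rintro ⟨⟨T, a⟩, l⟩ h1 ⟨⟨T', a'⟩, l'⟩ h2 he
      simp only [Finset.coe_sigma, Set.mem_sigma_iff, Finset.mem_coe, Finset.mem_sigma,
        Finset.mem_powerset] at h1 h2
      simp only [List.cons.injEq, Prod.mk.injEq] at he
      obtain ⟨⟨he, rfl⟩, rfl⟩ := he
      have : T = T' := by
        have e1 : ∀ U : Finset (Fin n), U ⊆ Gᶜ → (G ∪ U) \ G = U := by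
          intro U hU
          ext x
          have := @hU x
          simp at this ⊢
          tauto
        rw [← e1 T h1.1.1, ← e1 T' h2.1.1, he]
      subst this
      rfl

lemma Vd_ofFn (k : ℕ) : ∀ (G : Finset (Fin n)) (F : Fin k → Finset (Fin n)) (a : Fin k → ℕ),
    Vd G (List.ofFn fun i => (F i, a i)) ↔
      ∀ i : Fin k, (Fin.cons G F : Fin (k + 1) → Finset (Fin n)) i.castSucc ⊂ F i ∧
        1 ≤ a i ∧ a i + #((Fin.cons G F : Fin (k + 1) → Finset (Fin n)) i.castSucc) < #(F i) := by
  induction k with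
  | zero => intro G F a; simp [Vd]
  | succ k ih =>
    intro G F a
    rw [List.ofFn_succ, Vd, ih (F 0) (fun i => F i.succ) (fun i => a i.succ), Fin.forall_fin_succ]
    have hF : (Fin.cons (F 0) (fun i => F i.succ) : Fin (k + 1) → Finset (Fin n)) = F :=
      Fin.cons_self_tail F
    rw [hF]
    simp only [Fin.castSucc_zero, Fin.cons_zero, ← Fin.succ_castSucc, Fin.cons_succ]

lemma prevSet_eq {k : ℕ} (F : Fin k → Finset (Fin n)) (i : Fin k) :
    prevSet F i = (Fin.cons ∅ F : Fin (k + 1) → Finset (Fin n)) i.castSucc := by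
  cases k with
  | zero => exact i.elim0
  | succ k =>
    refine Fin.cases ?_ (fun i => ?_) i
    · simp [prevSet]
    · rw [← Fin.succ_castSucc, Fin.cons_succ]
      simp [prevSet]
      rfl

lemma isFY_iff (p : Σ k : ℕ, (Fin k → Finset (Fin n)) × (Fin k → ℕ)) :
    IsFY p ↔ Vd ∅ (List.ofFn fun i => (p.2.1 i, p.2.2 i)) := by
  obtain ⟨k, F, a⟩ := p
  rw [Vd_ofFn, IsFY]
  simp only [prevSet_eq]
  cases k with
  | zero => simp [StrictMono]
  | succ k =>
    rw [Fin.strictMono_iff_lt_succ]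
    constructor
    · rintro ⟨h1, h2⟩ i
      refine ⟨?_, h2 i⟩
      have h3 := h2 i
      revert h3
      refine Fin.cases ?_ (fun i => ?_) i
      · simp only [Fin.castSucc_zero, Fin.cons_zero]
        intro h3
        rw [Finset.empty_ssubset, ← Finset.card_pos]
        omega
      · intro _
        rw [← Fin.succ_castSucc, Fin.cons_succ]
        exact h1 i
    · intro h
      refine ⟨fun i => ?_, fun i => (h i).2⟩
      have := (h i.succ).1
      rwa [← Fin.succ_castSucc, Fin.cons_succ] at this

lemma card_FY (j : ℕ) : Nat.card {u : FYBn n // FYdeg u.1 = j} =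
    Nat.card {l : List (Finset (Fin n) × ℕ) // l ∈ chs n ∅ ∧ ldeg l = j} := by
  apply Nat.card_congr
  let e : (Σ k : ℕ, (Fin k → Finset (Fin n)) × (Fin k → ℕ)) ≃ List (Finset (Fin n) × ℕ) :=
    (Equiv.sigmaCongrRight fun k => (Equiv.arrowProdEquivProdArrow (Fin k)
      (fun _ => Finset (Fin n)) (fun _ => ℕ)).symm).trans List.equivSigmaTuple.symm
  have he : ∀ p, e p = List.ofFn fun i => (p.2.1 i, p.2.2 i) := fun p => rfl
  refine (Equiv.subtypeSubtypeEquivSubtypeInter (fun p => IsFY p) (fun p => FYdeg p = j)).trans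
    (Equiv.subtypeEquiv e fun p => ?_)
  rw [mem_chs _ _ _ (by simp), he, ← isFY_iff]
  have : ldeg (List.ofFn fun i => (p.2.1 i, p.2.2 i)) = FYdeg p := by
    rw [ldeg, List.map_ofFn, List.sum_ofFn, FYdeg]; rfl
  rw [this]

end Words

theorem stmt5 (n j : ℕ) :
    Nat.card {u : FYBn n // FYdeg u.1 = j} =
      Nat.card {σ : Equiv.Perm (Fin n) // des σ = j} := by
  have h1 := coeff_sum_pow (chs n (∅ : Finset (Fin n))) ldeg j
  have h2 := coeff_sum_pow (arr n (univ : Finset (Fin n))) wdes0 j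
  have h3 := sum_wdes0 (univ : Finset (Fin n))
  rw [Finset.card_univ, Fintype.card_fin] at h3
  rw [sum_chs n _ (by simp)] at h1
  rw [h3] at h2
  rw [card_FY, card_perm]
  simp only [Finset.card_empty, Nat.sub_zero] at h1
  exact_mod_cast h1.symm.trans h2
end

section
/- The number of elements of ~FY(B_n) of total degree j equals the coefficient of t^j in the binomial Eulerian polynomial Ã_n(t) = 1 + t·Σ_{k=1}^n C(n,k)·A_k(t). -/
open Finset

/-- Feichtner--Yuzvinsky-type basis data for the augmented Chow ring of `B_n`:
a strictly increasing chain `∅ = F₀ ⊊ F₁ ⊊ ⋯ ⊊ F_k ⊆ [n]` together with exponents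
`1 ≤ a₁ ≤ |F₁|` and `1 ≤ aᵢ ≤ |Fᵢ| - |Fᵢ₋₁| - 1` for `i ≥ 2`
(the case `k = 0` is the empty monomial). -/
def IsAugFY {n : ℕ} (p : Σ k : ℕ, (Fin k → Finset (Fin n)) × (Fin k → ℕ)) : Prop :=
  StrictMono p.2.1 ∧
  ∀ i : Fin p.1, 1 ≤ p.2.2 i ∧
    (if (i : ℕ) = 0 then p.2.2 i ≤ (p.2.1 i).card
     else p.2.2 i + (prevSet p.2.1 i).card < (p.2.1 i).card)

/-- the set `~FY(B_n)` -/
def AugFYBn (n : ℕ) := {p : Σ k : ℕ, (Fin k → Finset (Fin n)) × (Fin k → ℕ) // IsAugFY p}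

namespace AugEul

open Polynomial

/-! ### Eulerian polynomials: recursion through arrangements -/

section arr
variable {α : Type*} [LinearOrder α]

noncomputable def W : ℕ → Finset α → α → ℤ[X]
  | 0, _, _ => 1
  | n + 1, s, x => ∑ y ∈ s, (if y < x then X else 1) * W n (s.erase y) y

noncomputable def V : ℕ → Finset α → ℤ[X]
  | 0, _ => 1
  | n + 1, s => ∑ y ∈ s, W n (s.erase y) y

lemma sum_powerset_max {M : Type*} [AddCommMonoid M] (S : Finset α) (g : Finset α → M) :
    ∑ T ∈ S.powerset, g T
      = g ∅ + ∑ y ∈ S, ∑ T ∈ (S.filter (· < y)).powerset, g (insert y T) := by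
  induction S using Finset.induction_on_max with
  | empty => simp
  | insert a S ha ih =>
    have hna : a ∉ S := fun h => lt_irrefl _ (ha a h)
    rw [Finset.sum_powerset_insert hna, ih, Finset.sum_insert hna]
    have h1 : (insert a S).filter (· < a) = S := by
      ext z
      simp only [Finset.mem_filter, Finset.mem_insert]
      constructor
      · rintro ⟨rfl | h, h2⟩
        · exact absurd h2 (lt_irrefl _)
        · exact h
      · intro h; exact ⟨Or.inr h, ha z h⟩
    rw [h1]
    have h2 : ∀ y ∈ S, (insert a S).filter (· < y) = S.filter (· < y) := by
      intro y hy
      rw [Finset.filter_insert, if_neg (not_lt.mpr (ha y hy).le)]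
    have h4 : ∑ y ∈ S, ∑ T ∈ ((insert a S).filter (· < y)).powerset, g (insert y T)
        = ∑ y ∈ S, ∑ T ∈ (S.filter (· < y)).powerset, g (insert y T) :=
      Finset.sum_congr rfl (fun y hy => by rw [h2 y hy])
    rw [h4, add_assoc, add_comm (∑ T ∈ S.powerset, g (insert a T))]

lemma W_formula (n : ℕ) : ∀ (s : Finset α) (x : α), s.card = n →
    W n s x = ∑ T ∈ (s.filter (· < x)).powerset, (X - 1) ^ T.card * V (n - T.card) (s \ T) := by
  induction n with
  | zero =>
    intro s x hs
    obtain rfl := Finset.card_eq_zero.mp hs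
    simp [W, V]
  | succ n ih =>
    intro s x hs
    rw [sum_powerset_max]
    have e1 : W (n + 1) s x = V (n + 1) s
        + ∑ y ∈ s.filter (· < x), (X - 1) * W n (s.erase y) y := by
      rw [W, V, Finset.sum_filter, ← Finset.sum_add_distrib]
      refine Finset.sum_congr rfl fun y _ => ?_
      split_ifs <;> ring
    rw [e1]
    congr 1
    · simp
    · refine Finset.sum_congr rfl fun y hy => ?_
      have hy' := Finset.mem_filter.mp hy
      rw [ih _ _ (by rw [Finset.card_erase_of_mem hy'.1, hs]; rfl), Finset.mul_sum]
      have h1 : (s.erase y).filter (· < y) = (s.filter (· < x)).filter (· < y) := by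
        ext z
        simp only [Finset.mem_filter, Finset.mem_erase]
        constructor
        · rintro ⟨⟨_, h⟩, h2⟩; exact ⟨⟨h, h2.trans hy'.2⟩, h2⟩
        · rintro ⟨⟨h, _⟩, h2⟩; exact ⟨⟨h2.ne, h⟩, h2⟩
      rw [h1]
      refine Finset.sum_congr rfl fun T hT => ?_
      have hyT : y ∉ T := fun h => by
        have := Finset.mem_filter.mp (Finset.mem_powerset.mp hT h)
        exact lt_irrefl _ this.2
      rw [Finset.card_insert_of_notMem hyT, Nat.add_sub_add_right]
      have h3 : s.erase y \ T = s \ insert y T := by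
        ext z; simp only [Finset.mem_sdiff, Finset.mem_erase, Finset.mem_insert]; tauto
      rw [h3]; ring

lemma V_formula (n : ℕ) (s : Finset α) (hs : s.card = n + 1) :
    X * V (n + 1) s = ∑ T ∈ s.powerset, (X - 1) ^ T.card * V (n + 1 - T.card) (s \ T) := by
  rw [sum_powerset_max]
  have : ∀ y ∈ s, ∑ T ∈ (s.filter (· < y)).powerset,
      (X - 1) ^ (insert y T).card * V (n + 1 - (insert y T).card) (s \ insert y T)
      = (X - 1) * W n (s.erase y) y := by
    intro y hy
    rw [W_formula n _ _ (by rw [Finset.card_erase_of_mem hy, hs]; rfl), Finset.mul_sum]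
    have h1 : (s.erase y).filter (· < y) = s.filter (· < y) := by
      ext z
      simp only [Finset.mem_filter, Finset.mem_erase]
      constructor
      · rintro ⟨⟨_, h⟩, h2⟩; exact ⟨h, h2⟩
      · rintro ⟨h, h2⟩; exact ⟨⟨h2.ne, h⟩, h2⟩
    rw [h1]
    refine Finset.sum_congr rfl fun T hT => ?_
    have hyT : y ∉ T := fun h => by
      have := Finset.mem_filter.mp (Finset.mem_powerset.mp hT h)
      exact lt_irrefl _ this.2
    rw [Finset.card_insert_of_notMem hyT, Nat.add_sub_add_right]
    have h3 : s.erase y \ T = s \ insert y T := by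
      ext z; simp only [Finset.mem_sdiff, Finset.mem_erase, Finset.mem_insert]; tauto
    rw [h3]; ring
  rw [Finset.sum_congr rfl this, ← Finset.mul_sum]
  simp only [Finset.card_empty, pow_zero, one_mul, Nat.sub_zero, Finset.sdiff_empty]
  rw [V]; ring

end arr


noncomputable def A (n : ℕ) : ℤ[X] := V n (Finset.range n)

lemma V_step {α : Type*} [LinearOrder α] (n : ℕ)
    (ih : ∀ m < n + 1, ∀ s : Finset α, s.card = m → V m s = A m)
    (s : Finset α) (hs : s.card = n + 1) :
    (X - 1) * V (n + 1) s = ∑ m ∈ Finset.range (n + 2), (n + 1).choose m •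
      (if m = 0 then 0 else (X - 1) ^ m * A (n + 1 - m)) := by
  have h := V_formula n s hs
  rw [← Finset.add_sum_erase _ _ (Finset.empty_mem_powerset s)] at h
  simp only [Finset.card_empty, pow_zero, one_mul, Nat.sub_zero, Finset.sdiff_empty] at h
  have h2 := Finset.sum_powerset_apply_card
    (fun m => if m = 0 then (0 : ℤ[X]) else (X - 1) ^ m * A (n + 1 - m)) (x := s)
  rw [hs] at h2
  rw [← h2, ← Finset.add_sum_erase _ _ (Finset.empty_mem_powerset s)]
  have h3 : ∑ T ∈ s.powerset.erase ∅, (X - 1) ^ (T.card) * V (n + 1 - T.card) (s \ T)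
      = ∑ T ∈ s.powerset.erase ∅,
        (if T.card = 0 then (0 : ℤ[X]) else (X - 1) ^ T.card * A (n + 1 - T.card)) := by
    refine Finset.sum_congr rfl fun T hT => ?_
    have hT' := Finset.mem_erase.mp hT
    have hpos : 0 < T.card := Finset.card_pos.mpr (Finset.nonempty_iff_ne_empty.mpr hT'.1)
    rw [if_neg hpos.ne', ih _ (by omega)]
    rw [Finset.card_sdiff_of_subset (Finset.mem_powerset.mp hT'.2), hs]
  rw [h3] at h
  simp only [Finset.card_empty, if_true, zero_add]
  linear_combination h

lemma V_card {α : Type*} [LinearOrder α] (n : ℕ) :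
    ∀ (s : Finset α), s.card = n → V n s = A n := by
  induction n using Nat.strong_induction_on with
  | _ n ih =>
    intro s hs
    rcases n with _ | n
    · rfl
    · have hX : (X - 1 : ℤ[X]) ≠ 0 := by
        simpa using X_sub_C_ne_zero (1 : ℤ)
      apply mul_left_cancel₀ hX
      rw [V_step n ih s hs]
      have ih2 : ∀ m < n + 1, ∀ s : Finset ℕ, s.card = m → V m s = A m := by
        clear ih hs
        intro m
        induction m using Nat.strong_induction_on with
        | _ m ihm =>
          intro hm s hs
          rcases m with _ | m
          · rfl
          · apply mul_left_cancel₀ hX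
            have ihm' : ∀ k < m + 1, ∀ s : Finset ℕ, s.card = k → V k s = A k :=
              fun k hk => ihm k hk (by omega)
            rw [V_step m ihm' s hs, A, V_step m ihm' (Finset.range (m + 1)) (by simp)]
      rw [A, V_step n ih2 (Finset.range (n + 1)) (by simp)]

lemma A_zero : A 0 = 1 := rfl

lemma A_rec (n : ℕ) : ∑ m ∈ Finset.range (n + 1), n.choose m • ((X - 1) ^ m * A (n - m))
    = X * A n + (if n = 0 then 1 - X else 0) := by
  rcases n with _ | n
  · simp [A_zero]
  · have h := V_formula n (Finset.range (n + 1)) (by simp)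
    have h2 := Finset.sum_powerset_apply_card
      (fun m => (X - 1 : ℤ[X]) ^ m * A (n + 1 - m)) (x := Finset.range (n + 1))
    rw [Finset.card_range] at h2
    rw [← h2]
    simp only [Nat.succ_ne_zero, if_false, add_zero]
    rw [A, h]
    refine Finset.sum_congr rfl fun T hT => ?_
    rw [V_card (n + 1 - T.card) (Finset.range (n + 1) \ T)]
    rw [Finset.card_sdiff_of_subset (Finset.mem_powerset.mp hT), Finset.card_range]

/-- umbral functional -/
noncomputable def L : ℤ[X][X] →ₗ[ℤ[X]] ℤ[X] :=
  Polynomial.lsum fun n => LinearMap.mulRight ℤ[X] (A n)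

lemma L_C_mul_X_pow (c : ℤ[X]) (n : ℕ) : L (C c * X ^ n) = c * A n := by
  rw [C_mul_X_pow_eq_monomial, L, Polynomial.lsum_apply, sum_monomial_index] <;> simp

lemma L_add_pow (c : ℤ[X]) (n : ℕ) :
    L ((C c + X) ^ n) = ∑ m ∈ Finset.range (n + 1), n.choose m • (c ^ m * A (n - m)) := by
  rw [add_pow, map_sum]
  refine Finset.sum_congr rfl fun m _ => ?_
  rw [← L_C_mul_X_pow, ← map_nsmul, nsmul_eq_mul, C_pow, mul_comm]

lemma A_rec2 (n : ℕ) : ∑ m ∈ Finset.range (n + 1), n.choose m • (X ^ m * A (n - m))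
    = X * (∑ m ∈ Finset.range (n + 1), n.choose m • A (n - m)) + 1 - X := by
  rw [← L_add_pow]
  have h1 : ((C X + X : ℤ[X][X])) ^ n
      = ∑ m ∈ Finset.range (n + 1), n.choose m • (C (X - 1) + X) ^ (n - m) := by
    have : (C X + X : ℤ[X][X]) = 1 + (C (X - 1) + X) := by
      simp only [C_sub, C_1]; ring
    rw [this, add_pow]
    refine Finset.sum_congr rfl fun m _ => ?_
    rw [nsmul_eq_mul]; ring
  rw [h1, map_sum, Finset.mul_sum]
  simp only [map_nsmul, L_add_pow, A_rec, smul_add, Finset.sum_add_distrib, mul_smul_comm]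
  rw [add_sub_assoc]
  congr 1
  rw [Finset.sum_eq_single n]
  · simp
  · intro b hb hbn
    rw [Finset.mem_range] at hb
    rw [if_neg (by omega), smul_zero]
  · simp

/-- the recursion for the Feichtner--Yuzvinsky polynomial -/
lemma A_fy (n : ℕ) : A n = 1 + ∑ m ∈ Finset.range (n + 1),
    n.choose m • ((∑ a ∈ Finset.Ico 1 m, X ^ a) * A (n - m)) := by
  have hX : (X - 1 : ℤ[X]) ≠ 0 := by
    simpa using X_sub_C_ne_zero (1 : ℤ)
  apply mul_left_cancel₀ hX
  rw [mul_add, Finset.mul_sum]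
  have h := A_rec2 n
  rw [Finset.mul_sum] at h
  have e : ∀ m ∈ Finset.range (n + 1), (X - 1 : ℤ[X]) * n.choose m •
      ((∑ a ∈ Finset.Ico 1 m, X ^ a) * A (n - m))
      = n.choose m • (X ^ m * A (n - m)) - X * n.choose m • A (n - m)
        + (if m = 0 then (X - 1) * A n else 0) := by
    intro m _
    rcases m with _ | m
    · simp; ring
    · have : (∑ a ∈ Finset.Ico 1 (m + 1), X ^ a) * (X - 1 : ℤ[X]) = X ^ (m + 1) - X := by
        rw [geom_sum_Ico_mul _ (by omega)]; simp
      simp only [Nat.succ_ne_zero, if_false, add_zero, nsmul_eq_mul]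
      linear_combination ((n.choose (m + 1) : ℤ[X]) * A (n - (m + 1))) * this
  rw [Finset.sum_congr rfl e, Finset.sum_add_distrib, Finset.sum_sub_distrib,
    Finset.sum_ite_eq' ]
  rw [h, if_pos (by simp)]
  ring

lemma A_aug (n : ℕ) : X * ∑ k ∈ Finset.Icc 1 n, n.choose k • A k
    = ∑ m ∈ Finset.range (n + 1), n.choose m • ((∑ a ∈ Finset.Icc 1 m, X ^ a) * A (n - m)) := by
  have h := A_rec2 n
  have h2 := A_fy n
  have e : ∀ m ∈ Finset.range (n + 1), n.choose m •
      ((∑ a ∈ Finset.Icc 1 m, X ^ a) * A (n - m))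
      = n.choose m • (X ^ m * A (n - m)) + n.choose m • ((∑ a ∈ Finset.Ico 1 m, X ^ a) * A (n - m))
        - (if m = 0 then A n else 0) := by
    intro m _
    rcases m with _ | m
    · simp
    · have : (∑ a ∈ Finset.Icc 1 (m + 1), (X : ℤ[X]) ^ a)
          = ∑ a ∈ Finset.Ico 1 (m + 1), X ^ a + X ^ (m + 1) := by
        rw [← Finset.sum_Ico_succ_top (by omega)]; rfl
      rw [this]
      simp only [Nat.succ_ne_zero, if_false, nsmul_eq_mul]
      ring
  rw [Finset.sum_congr rfl e, Finset.sum_sub_distrib, Finset.sum_add_distrib,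
    Finset.sum_ite_eq', h, if_pos (by simp)]
  have h3 : ∑ m ∈ Finset.range (n + 1), n.choose m • A (n - m)
      = 1 + ∑ k ∈ Finset.Icc 1 n, n.choose k • A k := by
    rw [← Finset.sum_range_reflect]
    have : ∑ j ∈ Finset.range (n + 1), n.choose (n + 1 - 1 - j) • A (n - (n + 1 - 1 - j))
      = ∑ j ∈ Finset.range (n + 1), n.choose j • A j := by
      refine Finset.sum_congr rfl fun j hj => ?_
      rw [Finset.mem_range] at hj
      rw [Nat.add_sub_cancel, Nat.choose_symm (by omega), Nat.sub_sub_self (by omega)]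
    rw [this, Finset.range_eq_Ico, Finset.sum_eq_sum_Ico_succ_bot (by omega)]
    simp only [Nat.choose_zero_right, one_smul, A_zero]
    rfl
  rw [h3]
  linear_combination h2

/-! ### The link with permutations -/

def desF {α : Type*} [LinearOrder α] {n : ℕ} (f : Fin (n + 1) → α) : ℕ :=
  ∑ i : Fin n, if f i.succ < f i.castSucc then 1 else 0

lemma desF_cons {α : Type*} [LinearOrder α] {n : ℕ} (x : α) (f : Fin (n + 1) → α) :
    desF (Fin.cons x f : Fin (n + 2) → α) = (if f 0 < x then 1 else 0) + desF f := by
  rw [desF, Fin.sum_univ_succ, desF]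
  congr 1

def Arr {α : Type*} {n : ℕ} (s : Finset α) (f : Fin n → α) : Prop :=
  Function.Injective f ∧ ∀ i, f i ∈ s

lemma Arr_cons {α : Type*} [DecidableEq α] {n : ℕ} (s : Finset α) (y : α) (f : Fin n → α) :
    Arr s (Fin.cons y f : Fin (n + 1) → α) ↔ y ∈ s ∧ Arr (s.erase y) f := by
  unfold Arr
  rw [Fin.cons_injective_iff, Fin.forall_fin_succ]
  simp only [Fin.cons_zero, Fin.cons_succ, Finset.mem_erase, Set.mem_range, not_exists]
  constructor
  · rintro ⟨⟨h1, h2⟩, h3, h4⟩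
    exact ⟨h3, h2, fun i => ⟨h1 i, h4 i⟩⟩
  · rintro ⟨h3, h2, h⟩
    exact ⟨⟨fun i => (h i).1, h2⟩, h3, fun i => (h i).2⟩

open Classical in
lemma sum_Arr_succ {α : Type*} [LinearOrder α] [Fintype α] {n : ℕ} (s : Finset α)
    (g : (Fin (n + 1) → α) → ℤ[X]) :
    ∑ f : Fin (n + 1) → α, (if Arr s f then g f else 0)
    = ∑ y ∈ s, ∑ f : Fin n → α, if Arr (s.erase y) f then g (Fin.cons y f) else 0 := by
  rw [← (Fin.consEquiv (fun _ => α)).sum_comp, Fintype.sum_prod_type]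
  rw [← Finset.sum_subset (Finset.subset_univ s)]
  · refine Finset.sum_congr rfl fun y hy => Finset.sum_congr rfl fun f _ => ?_
    have := Arr_cons s y f
    simp only [hy, true_and] at this
    change (if Arr s (Fin.cons y f : Fin (n + 1) → α) then _ else _) = _
    simp only [this]
    rfl
  · intro y _ hy
    refine Finset.sum_eq_zero fun f _ => ?_
    have := Arr_cons s y f
    simp only [hy, false_and, iff_false] at this
    exact if_neg this

open Classical in
lemma W_sum {α : Type*} [LinearOrder α] [Fintype α] (n : ℕ) : ∀ (s : Finset α) (x : α),
    ∑ f : Fin n → α, (if Arr s f then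
      (X : ℤ[X]) ^ desF (Fin.cons x f : Fin (n + 1) → α) else 0) = W n s x := by
  induction n with
  | zero =>
    intro s x
    simp [W, desF, Arr, Function.injective_of_subsingleton]
  | succ n ih =>
    intro s x
    rw [sum_Arr_succ, W]
    refine Finset.sum_congr rfl fun y _ => ?_
    rw [← ih, Finset.mul_sum]
    refine Finset.sum_congr rfl fun f _ => ?_
    rw [desF_cons]
    simp only [Fin.cons_zero, pow_add]
    split_ifs <;> simp

lemma des_eq {n : ℕ} (σ : Equiv.Perm (Fin (n + 1))) : des σ = desF σ := by
  classical
  rw [des, desF, Finset.sum_boole, Nat.cast_id, ← Fintype.card_subtype, ← Nat.card_eq_fintype_card]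
  refine (Nat.card_congr (Equiv.ofBijective
    (fun i : {i : Fin n // σ i.succ < σ i.castSucc} =>
    (⟨i.1.castSucc, by
      refine ⟨by simp, ?_⟩
      exact i.2⟩ : {i : Fin (n + 1) // ∃ h : (i : ℕ) + 1 < n + 1, σ ⟨(i : ℕ) + 1, h⟩ < σ i}))
    ⟨?_, ?_⟩)).symm
  · intro i j h
    simp only [Subtype.mk.injEq] at h
    exact Subtype.ext (Fin.castSucc_injective _ h)
  · rintro ⟨i, h, h2⟩
    exact ⟨⟨⟨i, by omega⟩, h2⟩, rfl⟩

open Classical in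
lemma A_perm (n : ℕ) : ∑ σ : Equiv.Perm (Fin n), (X : ℤ[X]) ^ des σ = A n := by
  rcases n with _ | n
  · simp [A_zero, des]
  · rw [← V_card (n + 1) (Finset.univ : Finset (Fin (n + 1))) (by simp), V]
    simp only [← W_sum]
    rw [← sum_Arr_succ (Finset.univ : Finset (Fin (n + 1))) (fun f => X ^ desF f)]
    rw [← Finset.sum_filter]
    refine Finset.sum_bij' (fun σ _ => ⇑σ)
      (fun f hf => Equiv.ofBijective f (Finite.injective_iff_bijective.mp (Finset.mem_filter.mp hf).2.1))
      ?_ ?_ ?_ ?_ ?_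
    · intro σ _
      simp [Arr, σ.injective]
    · simp
    · intro σ _
      ext; simp
    · intro f hf
      rfl
    · intro σ _
      rw [des_eq]

lemma A_coeff (n j : ℕ) :
    (A n).coeff j = (Nat.card {σ : Equiv.Perm (Fin n) // des σ = j} : ℤ) := by
  classical
  rw [← A_perm, finsetSum_coeff, Nat.card_eq_fintype_card, Fintype.card_subtype]
  simp only [coeff_X_pow, Finset.sum_boole, eq_comm (a := j)]

/-! ### Chains as lists -/

def Good {n : ℕ} : Finset (Fin n) → List (Finset (Fin n) × ℕ) → Prop
  | _, [] => True
  | G, x :: l => G ⊂ x.1 ∧ 1 ≤ x.2 ∧ x.2 + G.card < x.1.card ∧ Good x.1 l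

def GoodAug {n : ℕ} : List (Finset (Fin n) × ℕ) → Prop
  | [] => True
  | x :: l => 1 ≤ x.2 ∧ x.2 ≤ x.1.card ∧ Good x.1 l

def deg {n : ℕ} (l : List (Finset (Fin n) × ℕ)) : ℕ := (l.map Prod.snd).sum

lemma exists_cons {n : ℕ} (j : ℕ) (𝓕 : Finset (Finset (Fin n))) (b : Finset (Fin n) → ℕ)
    (ih : ∀ F : Finset (Fin n), ∀ i ≤ j, ∃ s : Finset (List (Finset (Fin n) × ℕ)),
      (∀ l, l ∈ s ↔ Good F l ∧ deg l = i) ∧ (s.card : ℤ) = (A (n - F.card)).coeff i) :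
    ∃ s : Finset (List (Finset (Fin n) × ℕ)),
      (∀ l, l ∈ s ↔ (∃ x l', l = x :: l' ∧ x.1 ∈ 𝓕 ∧ 1 ≤ x.2 ∧ x.2 ≤ b x.1 ∧ Good x.1 l')
        ∧ deg l = j + 1) ∧
      (s.card : ℤ) = (∑ F ∈ 𝓕, (∑ a ∈ Finset.Icc 1 (b F), X ^ a) * A (n - F.card)).coeff (j + 1) := by
  classical
  have ih' : ∀ F : Finset (Fin n), ∀ i, ∃ s : Finset (List (Finset (Fin n) × ℕ)), i ≤ j →
      (∀ l, l ∈ s ↔ Good F l ∧ deg l = i) ∧ (s.card : ℤ) = (A (n - F.card)).coeff i := by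
    intro F i
    by_cases h : i ≤ j
    · obtain ⟨s, hs⟩ := ih F i h
      exact ⟨s, fun _ => hs⟩
    · exact ⟨∅, fun h' => absurd h' h⟩
  choose s hs using ih'
  let big : Finset (Σ _ : Finset (Fin n), Σ _ : ℕ, List (Finset (Fin n) × ℕ)) :=
    𝓕.sigma fun F => ((Finset.Icc 1 (b F)).filter (· ≤ j + 1)).sigma fun a => s F (j + 1 - a)
  have hinj : Function.Injective (fun y : (Σ _ : Finset (Fin n), Σ _ : ℕ,
      List (Finset (Fin n) × ℕ)) => (y.1, y.2.1) :: y.2.2) := by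
    rintro ⟨F, a, l⟩ ⟨F', a', l'⟩ h
    simp only [List.cons.injEq, Prod.mk.injEq] at h
    obtain ⟨⟨rfl, rfl⟩, rfl⟩ := h
    rfl
  refine ⟨big.image (fun y => (y.1, y.2.1) :: y.2.2), ?_, ?_⟩
  · intro l
    simp only [Finset.mem_image, big, Finset.mem_sigma, Finset.mem_filter, Finset.mem_Icc]
    constructor
    · rintro ⟨⟨F, a, l'⟩, ⟨hF, ⟨⟨h1, h2⟩, h3⟩, h4⟩, rfl⟩
      dsimp only at *
      rw [(hs F (j + 1 - a) (by omega)).1] at h4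
      refine ⟨⟨(F, a), l', rfl, hF, h1, h2, h4.1⟩, ?_⟩
      have := h4.2
      simp only [deg, List.map_cons, List.sum_cons] at this ⊢
      omega
    · rintro ⟨⟨⟨F, a⟩, l', rfl, hF, h1, h2, h3⟩, h4⟩
      dsimp only at *
      have h5 : a + deg l' = j + 1 := by
        simpa only [deg, List.map_cons, List.sum_cons] using h4
      refine ⟨⟨F, a, l'⟩, ⟨hF, ⟨⟨h1, h2⟩, by dsimp only; omega⟩, ?_⟩, rfl⟩
      dsimp only
      rw [(hs F (j + 1 - a) (by omega)).1]
      exact ⟨h3, by omega⟩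
  · rw [Finset.card_image_of_injective _ hinj, Finset.card_sigma, finsetSum_coeff, Nat.cast_sum]
    refine Finset.sum_congr rfl fun F _ => ?_
    rw [Finset.card_sigma, Finset.sum_mul, finsetSum_coeff, Finset.sum_filter, Nat.cast_sum]
    refine Finset.sum_congr rfl fun a ha => ?_
    rw [Finset.mem_Icc] at ha
    rw [coeff_X_pow_mul']
    split_ifs with h
    · exact (hs F (j + 1 - a) (by omega)).2
    · rfl

lemma sum_superset {n : ℕ} (G : Finset (Fin n)) (g : ℕ → ℤ[X]) :
    ∑ F ∈ Finset.univ.filter (G ⊆ ·), g F.card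
      = ∑ m ∈ Finset.range (n - G.card + 1), (n - G.card).choose m • g (m + G.card) := by
  have h := Finset.sum_powerset_apply_card (fun m => g (m + G.card)) (x := Gᶜ)
  rw [Finset.card_compl, Fintype.card_fin] at h
  rw [← h]
  refine Finset.sum_bij' (fun F _ => F \ G) (fun T _ => T ∪ G) ?_ ?_ ?_ ?_ ?_
  · intro F hF
    simp only [Finset.mem_powerset]
    intro x hx
    simp only [Finset.mem_sdiff] at hx
    simpa using hx.2
  · intro T _
    simp
  · intro F hF
    simp only [Finset.mem_filter] at hF
    exact Finset.sdiff_union_of_subset hF.2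
  · intro T hT
    rw [Finset.mem_powerset] at hT
    rw [Finset.union_sdiff_right, Finset.sdiff_eq_self_iff_disjoint]
    exact (Finset.disjoint_left.mpr fun x hx => by simpa using hT hx)
  · intro F hF
    simp only [Finset.mem_filter] at hF
    rw [Finset.card_sdiff_add_card_eq_card hF.2]

lemma good_count {n : ℕ} (j : ℕ) : ∀ G : Finset (Fin n),
    ∃ s : Finset (List (Finset (Fin n) × ℕ)),
      (∀ l, l ∈ s ↔ Good G l ∧ deg l = j) ∧ (s.card : ℤ) = (A (n - G.card)).coeff j := by
  induction j using Nat.strong_induction_on with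
  | _ j ih =>
    intro G
    have hA := congrArg (fun p => p.coeff j) (A_fy (n - G.card))
    rcases j with _ | j
    · refine ⟨{[]}, ?_, ?_⟩
      · intro l
        rcases l with _ | ⟨x, l⟩
        · simp [Good, deg]
        · simp only [Finset.mem_singleton, Good, deg, List.map_cons, List.sum_cons]
          constructor
          · intro h; cases h
          · rintro ⟨⟨_, h, _⟩, h2⟩; omega
      · rw [hA, coeff_add, finsetSum_coeff, Finset.sum_eq_zero]
        · simp
        · intro m _
          rw [coeff_smul, mul_coeff_zero, finsetSum_coeff, Finset.sum_eq_zero]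
          · simp
          · intro a ha
            rw [Finset.mem_Ico] at ha
            rw [coeff_X_pow, if_neg (by omega)]
    · obtain ⟨s, hs, hc⟩ := exists_cons j (Finset.univ.filter (G ⊆ ·)) (fun F => F.card - G.card - 1)
        (fun F i hi => ih i (by omega) F)
      refine ⟨s, ?_, ?_⟩
      · intro l
        rw [hs]
        refine and_congr_left fun hd => ?_
        rcases l with _ | ⟨x, l⟩
        · simp [deg] at hd
        · simp only [Good]
          constructor
          · rintro ⟨x', l', h, h1, h2, h3, h4⟩
            cases h
            simp only [Finset.mem_filter, Finset.mem_univ, true_and] at h1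
            refine ⟨lt_of_le_of_ne h1 ?_, h2, by omega, h4⟩
            rintro rfl
            omega
          · rintro ⟨h1, h2, h3, h4⟩
            exact ⟨x, l, rfl, by simpa using h1.subset, h2, by omega, h4⟩
      · rw [hc, hA, coeff_add, coeff_one, if_neg (by omega), zero_add]
        rw [sum_superset G (fun c => (∑ a ∈ Finset.Icc 1 (c - G.card - 1), X ^ a) * A (n - c))]
        congr 1
        refine Finset.sum_congr rfl fun m _ => ?_
        have e1 : n - (m + G.card) = n - G.card - m := by omega
        have e2 : Finset.Icc 1 (m + G.card - G.card - 1) = Finset.Ico 1 m := by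
          ext z; simp only [Finset.mem_Icc, Finset.mem_Ico]; omega
        rw [e1, e2]

lemma goodAug_count (n j : ℕ) :
    (Nat.card {l : List (Finset (Fin n) × ℕ) // GoodAug l ∧ deg l = j + 1} : ℤ)
      = (X * ∑ k ∈ Finset.Icc 1 n, n.choose k • A k).coeff (j + 1) := by
  obtain ⟨s, hs, hc⟩ := exists_cons j (Finset.univ.filter ((∅ : Finset (Fin n)) ⊆ ·))
    (fun F => F.card) (fun F i _ => good_count i F)
  have : ∀ l, l ∈ s ↔ GoodAug l ∧ deg l = j + 1 := by
    intro l
    rw [hs]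
    refine and_congr_left fun hd => ?_
    rcases l with _ | ⟨x, l⟩
    · simp [deg] at hd
    · simp only [GoodAug]
      constructor
      · rintro ⟨x', l', h, h1, h2, h3, h4⟩
        cases h
        exact ⟨h2, h3, h4⟩
      · rintro ⟨h2, h3, h4⟩
        exact ⟨x, l, rfl, by simp, h2, h3, h4⟩
  rw [Nat.subtype_card s this, hc, A_aug]
  rw [sum_superset ∅ (fun c => (∑ a ∈ Finset.Icc 1 c, X ^ a) * A (n - c))]
  simp

/-! ### Translation of the frozen definitions -/

lemma prevSet_cons {n k : ℕ} (F : Fin k → Finset (Fin n)) (i : Fin k) :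
    prevSet F i = (Fin.cons ∅ F : Fin (k + 1) → Finset (Fin n)) i.castSucc := by
  rcases k with _ | k
  · exact i.elim0
  · refine Fin.cases ?_ (fun i => ?_) i
    · simp [prevSet]
    · rw [← Fin.succ_castSucc, Fin.cons_succ]
      simp only [prevSet, Fin.val_succ, Nat.succ_pos, dif_pos]
      rfl

def Q {n k : ℕ} (G : Finset (Fin n)) (F : Fin k → Finset (Fin n)) (a : Fin k → ℕ) : Prop :=
  ∀ i : Fin k, (Fin.cons G F : Fin (k + 1) → Finset (Fin n)) i.castSucc ⊂ F i ∧ 1 ≤ a i ∧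
    a i + ((Fin.cons G F : Fin (k + 1) → Finset (Fin n)) i.castSucc).card < (F i).card

lemma Q_good {n : ℕ} (k : ℕ) : ∀ (G : Finset (Fin n)) (F : Fin k → Finset (Fin n)) (a : Fin k → ℕ),
    Q G F a ↔ Good G (List.ofFn fun i => (F i, a i)) := by
  induction k with
  | zero => intro G F a; simp [Q, Good]
  | succ k ih =>
    intro G F a
    rw [List.ofFn_succ]
    simp only [Good]
    rw [← ih (F 0) (fun i => F i.succ) (fun i => a i.succ), Q, Fin.forall_fin_succ, Q]
    have : ∀ i : Fin k, (Fin.cons G F : Fin (k + 2) → Finset (Fin n)) i.succ.castSucc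
        = (Fin.cons (F 0) (fun i => F i.succ) : Fin (k + 1) → Finset (Fin n)) i.castSucc := by
      intro i
      rw [← Fin.succ_castSucc, Fin.cons_succ]
      exact congrFun (Fin.cons_self_tail F).symm _
    simp only [this, Fin.castSucc_zero, Fin.cons_zero, and_assoc]

lemma aug_good {n : ℕ} (k : ℕ) (F : Fin k → Finset (Fin n)) (a : Fin k → ℕ) :
    IsAugFY ⟨k, F, a⟩ ↔ GoodAug (List.ofFn fun i => (F i, a i)) := by
  rcases k with _ | k
  · simp [IsAugFY, GoodAug, Subsingleton.strictMono]
  · rw [List.ofFn_succ]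
    simp only [GoodAug]
    rw [← Q_good k (F 0) (fun i => F i.succ) (fun i => a i.succ), IsAugFY, Q]
    simp only [Fin.forall_fin_succ, Fin.val_zero, if_true, Fin.val_succ, Nat.succ_ne_zero, if_false,
      Fin.strictMono_iff_lt_succ, prevSet_cons]
    have : ∀ i : Fin k, (Fin.cons ∅ F : Fin (k + 2) → Finset (Fin n)) i.succ.castSucc
        = F i.castSucc := by
      intro i
      rw [← Fin.succ_castSucc, Fin.cons_succ]
    have h2 : ∀ i : Fin k, (Fin.cons (F 0) (fun i => F i.succ) : Fin (k + 1) → Finset (Fin n))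
        i.castSucc = F i.castSucc := by
      intro i
      exact congrFun (Fin.cons_self_tail F) _
    simp only [this, h2]
    constructor
    · rintro ⟨h, ⟨h3, h4⟩, h5⟩
      exact ⟨h3, h4, fun i => ⟨h i, h5 i⟩⟩
    · rintro ⟨h3, h4, h5⟩
      exact ⟨fun i => (h5 i).1, ⟨h3, h4⟩, fun i => (h5 i).2⟩

lemma deg_ofFn {n : ℕ} (k : ℕ) (F : Fin k → Finset (Fin n)) (a : Fin k → ℕ) :
    FYdeg ⟨k, F, a⟩ = deg (List.ofFn fun i => (F i, a i)) := by
  rw [deg, List.map_ofFn, List.sum_ofFn]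
  rfl

def listEquiv (n : ℕ) : (Σ k : ℕ, (Fin k → Finset (Fin n)) × (Fin k → ℕ)) ≃
    List (Finset (Fin n) × ℕ) :=
  (Equiv.sigmaCongrRight fun _ => (Equiv.arrowProdEquivProdArrow _ _ _).symm).trans
    List.equivSigmaTuple.symm

lemma card_eq (n j : ℕ) : Nat.card {u : AugFYBn n // FYdeg u.1 = j}
    = Nat.card {l : List (Finset (Fin n) × ℕ) // GoodAug l ∧ deg l = j} := by
  refine Nat.card_congr ((Equiv.subtypeSubtypeEquivSubtypeInter
    (fun p : (Σ k : ℕ, (Fin k → Finset (Fin n)) × (Fin k → ℕ)) => IsAugFY p)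
    (fun p => FYdeg p = j)).trans ((listEquiv n).subtypeEquiv ?_))
  rintro ⟨k, F, a⟩
  rw [aug_good, deg_ofFn]
  rfl

lemma main (n j : ℕ) :
    Nat.card {u : AugFYBn n // FYdeg u.1 = j} =
      if j = 0 then 1
      else ∑ k ∈ Finset.Icc 1 n,
        n.choose k * Nat.card {σ : Equiv.Perm (Fin k) // des σ = j - 1} := by
  rw [card_eq]
  rcases j with _ | j
  · rw [if_pos rfl, Nat.subtype_card {[]}]
    · simp
    · intro l
      rcases l with _ | ⟨x, l⟩
      · simp [GoodAug, deg]
      · simp only [Finset.mem_singleton, GoodAug, deg, List.map_cons, List.sum_cons]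
        constructor
        · intro h; cases h
        · rintro ⟨⟨h, _⟩, h2⟩; omega
  · have h := goodAug_count n j
    rw [coeff_X_mul, finsetSum_coeff] at h
    rw [if_neg (Nat.succ_ne_zero j), Nat.add_sub_cancel]
    apply Nat.cast_injective (R := ℤ)
    rw [h, Nat.cast_sum]
    refine Finset.sum_congr rfl fun k _ => ?_
    rw [coeff_smul, A_coeff, nsmul_eq_mul, Nat.cast_mul]

end AugEul

theorem stmt10 (n j : ℕ) :
    Nat.card {u : AugFYBn n // FYdeg u.1 = j} =
      if j = 0 then 1
      else ∑ k ∈ Finset.Icc 1 n,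
        n.choose k * Nat.card {σ : Equiv.Perm (Fin k) // des σ = j - 1} := by
  exact AugEul.main n j
end

section
/- For the Boolean matroid B_n with the maximal building set on its lattice of flats, the monomials x_{F_1}^{a_1}···x_{F_k}^{a_k} with ∅ ⊊ F_1 ⊊ ... ⊊ F_k ⊆ [n] and 1 ≤ a_i ≤ |F_i| − |F_{i−1}| − 1 span the Chow ring A(B_n) = ℚ[x_F : ∅ ≠ F ⊆ [n]]/(I + J), where I is generated by products x_F x_G for incomparable F, G and J is generated by Σ_{F ∋ i} x_F for i ∈ [n], and they are linearly independent. -/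
open Finset

/-- the defining ideal `I + J` of the Chow ring of the Boolean matroid `B_n`:
`I` is generated by the products `x_F x_G` for incomparable `F, G` and `J` by the
linear forms `∑_{F ∋ i} x_F` for `i ∈ [n]`. -/
noncomputable def chowIdeal (n : ℕ) : Ideal (MvPolynomial {F : Finset (Fin n) // F.Nonempty} ℚ) :=
  Ideal.span
    ({q | ∃ F G : {F : Finset (Fin n) // F.Nonempty},
        ¬ F.1 ⊆ G.1 ∧ ¬ G.1 ⊆ F.1 ∧ q = MvPolynomial.X F * MvPolynomial.X G} ∪
     {q | ∃ i : Fin n,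
        q = ∑ F ∈ Finset.univ.filter
              (fun F : {F : Finset (Fin n) // F.Nonempty} => i ∈ F.1),
            MvPolynomial.X F})

/-- the monomial `x_{F₁}^{a₁} ⋯ x_{F_k}^{a_k}` attached to a chain with exponents -/
noncomputable def fyMonomial {n : ℕ}
    (p : Σ k : ℕ, (Fin k → Finset (Fin n)) × (Fin k → ℕ)) :
    MvPolynomial {F : Finset (Fin n) // F.Nonempty} ℚ :=
  ∏ i : Fin p.1,
    (if h : (p.2.1 i).Nonempty then MvPolynomial.X ⟨p.2.1 i, h⟩ else 1) ^ p.2.2 i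


namespace FY

lemma downInd {n : ℕ} {P : Finset (Fin n) → Prop}
    (h : ∀ F, (∀ H, F ⊂ H → P H) → P F) (F : Finset (Fin n)) : P F :=
  WellFoundedGT.induction (motive := P) F (fun F ih => h F (fun H hH => ih H hH))

def Good {n : ℕ} : Finset (Fin n) → List (Finset (Fin n) × ℕ) → Prop
  | _, [] => True
  | G, p :: l => G ⊂ p.1 ∧ 1 ≤ p.2 ∧ p.2 + G.card < p.1.card ∧ Good p.1 l

def mon {n : ℕ} {A : Type*} [CommRing A] (x : Finset (Fin n) → A)
    (l : List (Finset (Fin n) × ℕ)) : A := (l.map (fun p => x p.1 ^ p.2)).prod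

structure Rel {n : ℕ} {k A : Type*} [CommRing k] [CommRing A] [Algebra k A]
    (t : Fin n → k) (x : Finset (Fin n) → A) : Prop where
  one : x ∅ = 1
  inc : ∀ F G, ¬ F ⊆ G → ¬ G ⊆ F → x F * x G = 0
  lin : ∀ i, ∑ H ∈ Finset.univ.filter (fun H : Finset (Fin n) => i ∈ H), x H = algebraMap k A (t i)

section Span
variable {n : ℕ} {k A : Type*} [CommRing k] [CommRing A] [Algebra k A]
    {t : Fin n → k} {x : Finset (Fin n) → A}

/-- the key relation -/
lemma key (hx : Rel t x) (F : Finset (Fin n)) : ∀ (m : ℕ) (G : Finset (Fin n)), (F \ G).card = m →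
    ¬ F ⊆ G →
    x G * ∏ j ∈ F \ G, ((∑ H ∈ Finset.univ.filter (fun H => F ⊆ H), x H) - algebraMap k A (t j)) = 0 := by
  intro m
  induction m using Nat.strong_induction_on with
  | _ m ih =>
  intro G hm hFG
  obtain ⟨i, hiF, hiG⟩ := Finset.not_subset.mp hFG
  have hi : i ∈ F \ G := by simp [hiF, hiG]
  rw [← Finset.mul_prod_erase _ _ hi, ← hx.lin i]
  have e : (∑ H ∈ Finset.univ.filter (fun H => F ⊆ H), x H)
      - ∑ H ∈ Finset.univ.filter (fun H : Finset (Fin n) => i ∈ H), x H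
      = - ∑ H ∈ Finset.univ.filter (fun H : Finset (Fin n) => i ∈ H ∧ ¬ F ⊆ H), x H := by
    have : Finset.univ.filter (fun H => F ⊆ H)
        = (Finset.univ.filter (fun H : Finset (Fin n) => i ∈ H)).filter (fun H => F ⊆ H) := by
      ext H; simp only [Finset.mem_filter, Finset.mem_univ, true_and]
      exact ⟨fun h => ⟨h hiF, h⟩, fun h => h.2⟩
    rw [this, ← Finset.sum_filter_add_sum_filter_not (Finset.univ.filter (fun H : Finset (Fin n) => i ∈ H)) (fun H => F ⊆ H) x, Finset.filter_filter (p := fun H : Finset (Fin n) => i ∈ H) (q := fun H => ¬ F ⊆ H)]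
    ring
  rw [e, neg_mul, mul_neg, Finset.sum_mul, Finset.mul_sum, neg_eq_zero]
  apply Finset.sum_eq_zero
  intro H hH
  simp only [Finset.mem_filter, Finset.mem_univ, true_and] at hH
  obtain ⟨hiH, hFH⟩ := hH
  by_cases hGH : G ⊆ H
  · have hsub : F \ H ⊆ (F \ G).erase i := by
      intro j hj
      simp only [Finset.mem_sdiff, Finset.mem_erase] at hj ⊢
      exact ⟨fun h => hj.2 (h ▸ hiH), hj.1, fun h => hj.2 (hGH h)⟩
    have hlt : (F \ H).card < m := by
      have := Finset.card_le_card hsub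
      rw [Finset.card_erase_of_mem hi] at this
      have : 0 < (F \ G).card := Finset.card_pos.mpr ⟨i, hi⟩
      omega
    have h0 := ih _ hlt H rfl hFH
    rw [← Finset.prod_sdiff hsub]
    linear_combination (x G * ∏ j ∈ (F \ G).erase i \ (F \ H), ((∑ H ∈ Finset.univ.filter (fun H => F ⊆ H), x H) - algebraMap k A (t j))) * h0
  · have h0 := hx.inc G H hGH (fun h => hiG (h hiH))
    rw [← mul_assoc, h0, zero_mul]

variable (k) in
/-- span of the FY monomials above `G` -/
def W (x : Finset (Fin n) → A) (G : Finset (Fin n)) : Submodule k A :=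
  Submodule.span k {y | ∃ l, Good G l ∧ y = mon x l}

variable (k) in
def S (x : Finset (Fin n) → A) (G : Finset (Fin n)) : Subalgebra k A :=
  Algebra.adjoin k {y | ∃ F, G ⊂ F ∧ y = x F}

variable (k) in
def U (x : Finset (Fin n) → A) (G : Finset (Fin n)) : Submodule k A :=
  Submodule.span k ({1} ∪ {y | ∃ F a z, G ⊂ F ∧ 1 ≤ a ∧ z ∈ S k x F ∧ y = x F ^ a * z})

lemma S_mem {G F : Finset (Fin n)} (h : G ⊂ F) : x F ∈ S k x G :=
  Algebra.subset_adjoin ⟨F, h, rfl⟩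

lemma S_anti {G F : Finset (Fin n)} (h : G ⊆ F) : S k x F ≤ S k x G :=
  Algebra.adjoin_mono (by rintro y ⟨H, hH, rfl⟩; exact ⟨H, lt_of_le_of_lt h hH, rfl⟩)

lemma S_le_U (hx : Rel t x) (G : Finset (Fin n)) (z : A) (hz : z ∈ S k x G) : z ∈ U k x G := by
  have hmul : ∀ F, G ⊂ F → ∀ u ∈ U k x G, x F * u ∈ U k x G := by
    intro F hF u hu
    induction hu using Submodule.span_induction with
    | mem u hu =>
      rcases hu with hu | ⟨H, a, z, hH, ha, hz, rfl⟩
      · rw [Set.mem_singleton_iff.mp hu]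
        exact Submodule.subset_span (Or.inr ⟨F, 1, 1, hF, le_rfl, one_mem _, by simp⟩)
      · by_cases h1 : F ⊆ H
        · by_cases h2 : F = H
          · subst h2
            exact Submodule.subset_span (Or.inr ⟨F, a + 1, z, hF, by omega, hz, by ring⟩)
          · have h3 : F ⊂ H := lt_of_le_of_ne h1 h2
            exact Submodule.subset_span (Or.inr ⟨F, 1, x H ^ a * z, hF, le_rfl,
              mul_mem (pow_mem (S_mem h3) _) (S_anti h1 hz), by ring⟩)
        · by_cases h2 : H ⊆ F
          · have h3 : H ⊂ F := lt_of_le_of_ne h2 (fun h => h1 h.ge)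
            exact Submodule.subset_span (Or.inr ⟨H, a, x F * z, hH, ha,
              mul_mem (S_mem h3) hz, by ring⟩)
          · have h0 := hx.inc F H h1 h2
            obtain ⟨b, rfl⟩ : ∃ b, a = b + 1 := ⟨a - 1, by omega⟩
            have : x F * (x H ^ (b+1) * z) = 0 := by
              linear_combination (x H ^ b * z) * h0
            rw [this]; exact zero_mem _
    | zero => simp
    | add u v _ _ hu hv => rw [mul_add]; exact add_mem hu hv
    | smul c u _ hu => rw [mul_smul_comm]; exact Submodule.smul_mem _ _ hu
  have : ∀ u ∈ U k x G, z * u ∈ U k x G := by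
    unfold S at hz
    induction hz using Algebra.adjoin_induction with
    | mem y hy => obtain ⟨F, hF, rfl⟩ := hy; exact hmul F hF
    | algebraMap c => intro u hu; rw [← Algebra.smul_def]; exact Submodule.smul_mem _ _ hu
    | add y z _ _ h1 h2 => intro u hu; rw [add_mul]; exact add_mem (h1 u hu) (h2 u hu)
    | mul y z _ _ h1 h2 => intro u hu; rw [mul_assoc]; exact h1 _ (h2 u hu)
  simpa using this 1 (Submodule.subset_span (Or.inl rfl))

variable (k) in
def T (x : Finset (Fin n) → A) (G : Finset (Fin n)) : Submodule k A :=
  (W k x G).map (LinearMap.mulLeft k (x G))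

lemma T_mem {G : Finset (Fin n)} {w : A} (h : w ∈ W k x G) : x G * w ∈ T k x G :=
  ⟨w, h, rfl⟩

lemma one_mem_W (G : Finset (Fin n)) : (1 : A) ∈ W k x G :=
  Submodule.subset_span ⟨[], trivial, by simp [mon]⟩

lemma cons_mem_W {G F : Finset (Fin n)} {a : ℕ} (h : G ⊂ F) (ha : 1 ≤ a) (hd : a + G.card < F.card)
    {w : A} (hw : w ∈ W k x F) : x F ^ a * w ∈ W k x G := by
  unfold W at hw
  induction hw using Submodule.span_induction with
  | mem u hu =>
    obtain ⟨l, hl, rfl⟩ := hu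
    exact Submodule.subset_span ⟨(F, a) :: l, ⟨h, ha, hd, hl⟩, by simp [mon]⟩
  | zero => simp
  | add u v _ _ hu hv => rw [mul_add]; exact add_mem hu hv
  | smul c u _ hu => rw [mul_smul_comm]; exact Submodule.smul_mem _ _ hu

lemma U_to_T (G F : Finset (Fin n)) 
    (hR : ∀ H, F ⊂ H → ∀ a, 1 ≤ a → ∀ z ∈ S k x H, x G * (x H ^ a * z) ∈ T k x G)
    (u : A) (hu : u ∈ U k x F) : x G * u ∈ T k x G := by
  induction hu using Submodule.span_induction with
  | mem u hu =>
    rcases hu with hu | ⟨H, a, z, hH, ha, hz, rfl⟩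
    · rw [Set.mem_singleton_iff.mp hu]; exact T_mem (one_mem_W G)
    · exact hR H hH a ha z hz
  | zero => simp
  | add u v _ _ hu hv => rw [mul_add]; exact add_mem hu hv
  | smul c u _ hu => rw [mul_smul_comm]; exact Submodule.smul_mem _ _ hu

lemma R (hx : Rel t x) (G : Finset (Fin n))
    (hclaim : ∀ F, G ⊂ F → ∀ z ∈ S k x F, x F * z ∈ T k x F) :
    ∀ (F : Finset (Fin n)), G ⊂ F → ∀ a, 1 ≤ a → ∀ z ∈ S k x F, x G * (x F ^ a * z) ∈ T k x G := by
  intro F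
  induction F using downInd with
  | _ F ihF =>
  intro hGF a
  induction a using Nat.strong_induction_on with
  | _ a iha =>
  intro ha z hz
  by_cases hd : a + G.card < F.card
  · obtain ⟨w, hw, e⟩ := hclaim F hGF z hz
    obtain ⟨b, rfl⟩ : ∃ b, a = b + 1 := ⟨a - 1, by omega⟩
    have e' : x F * w = x F * z := e
    have : x F ^ (b+1) * z = x F ^ (b+1) * w := by
      linear_combination - x F ^ b * e'
    rw [this]
    exact T_mem (cons_mem_W hGF ha hd hw)
  · have hFG : ¬ F ⊆ G := fun h => (ne_of_lt hGF) (le_antisymm hGF.le h)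
    have h0 := key hx F _ G rfl hFG
    have hz0 : (∑ H ∈ Finset.univ.filter (fun H => F ⊂ H), x H) ∈ S k x F :=
      sum_mem fun H hH => S_mem (by simpa using hH)
    set z0 := ∑ H ∈ Finset.univ.filter (fun H => F ⊂ H), x H with hz0def
    have hy : (∑ H ∈ Finset.univ.filter (fun H => F ⊆ H), x H) = x F + z0 := by
      have : Finset.univ.filter (fun H => F ⊆ H) = insert F (Finset.univ.filter (fun H => F ⊂ H)) := by
        ext H
        simp only [Finset.mem_filter, Finset.mem_univ, true_and, Finset.mem_insert]
        constructor
        · intro h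
          by_cases h' : H = F
          · exact Or.inl h'
          · exact Or.inr (lt_of_le_of_ne h (Ne.symm h'))
        · rintro (rfl | h)
          · exact le_rfl
          · exact h.le
      rw [this, Finset.sum_insert (by simp)]
    simp only [hy, add_sub_assoc] at h0
    rw [Finset.prod_add] at h0
    simp only [Finset.prod_const] at h0
    rw [← Finset.insert_erase (Finset.mem_powerset_self (F \ G)), Finset.sum_insert (by simp)] at h0
    simp only [Finset.sdiff_self, Finset.prod_empty, mul_one] at h0
    have hcard : (F \ G).card + G.card = F.card := Finset.card_sdiff_add_card_eq_card hGF.le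
    obtain ⟨b, rfl⟩ : ∃ b, a = b + (F \ G).card := ⟨a - (F \ G).card, by omega⟩
    set D := F \ G
    set e : Finset (Fin n) → A := fun s => ∏ i ∈ D \ s, (z0 - algebraMap k A (t i))
    have he : ∀ s, e s ∈ S k x F := fun s => prod_mem fun i _ => sub_mem hz0 (algebraMap_mem _ _)
    have h1 : x G * (x F ^ (b + D.card) * z)
        = - ∑ s ∈ D.powerset.erase D, x G * (x F ^ (b + s.card) * (e s * z)) := by
      have : ∑ s ∈ D.powerset.erase D, x G * (x F ^ (b + s.card) * (e s * z))
          = x G * x F ^ b * z * ∑ s ∈ D.powerset.erase D, x F ^ s.card * e s := by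
        rw [Finset.mul_sum]; apply Finset.sum_congr rfl; intros; ring
      rw [this]
      linear_combination (x F ^ b * z) * h0
    rw [h1]
    refine neg_mem (sum_mem fun s hs => ?_)
    have hs' : s ⊂ D := by
      simp only [Finset.mem_erase, Finset.mem_powerset] at hs
      exact lt_of_le_of_ne hs.2 hs.1
    have hlt := Finset.card_lt_card hs'
    by_cases hb : 1 ≤ b + s.card
    · exact iha _ (by omega) hb _ (mul_mem (he s) hz)
    · have : b + s.card = 0 := by omega
      rw [this, pow_zero, one_mul]
      apply U_to_T G F _ _ (S_le_U hx F _ (mul_mem (he s) hz))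
      intro H hH
      exact ihF H hH (hGF.trans hH)

lemma claim (hx : Rel t x) : ∀ (G : Finset (Fin n)), ∀ z ∈ S k x G, x G * z ∈ T k x G := by
  intro G
  induction G using downInd with
  | _ G ih =>
  intro z hz
  exact U_to_T G G (R hx G ih) z
    (S_le_U hx G z hz)

theorem span_main (hx : Rel t x) (z : A) (hz : z ∈ Algebra.adjoin k (Set.range x)) :
    z ∈ W k x ∅ := by
  have hle : Algebra.adjoin k (Set.range x) ≤ S k x ∅ := by
    apply Algebra.adjoin_le
    rintro _ ⟨F, rfl⟩
    by_cases hF : F = ∅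
    · rw [hF, hx.one]; exact one_mem _
    · exact S_mem (Finset.empty_ssubset.mpr (Finset.nonempty_iff_ne_empty.mpr hF))
  obtain ⟨w, hw, e⟩ := claim hx ∅ z (hle hz)
  have e' : x ∅ * w = x ∅ * z := e
  rw [hx.one, one_mul, one_mul] at e'
  exact e' ▸ hw

end Span

section Indep
variable {n : ℕ} {k : Type*} [CommRing k]

def hd (t : Fin n → k) : List (Fin n) → k
  | [] => 0
  | j :: _ => t j

def pt (t : Fin n → k) : Finset (Fin n) → List (Fin n) → Finset (Fin n) → k
  | _, [], _ => 0
  | G, i :: w, H => if H = insert i G then t i - hd t w else pt t (insert i G) w H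

lemma pt_supp (t : Fin n → k) : ∀ (w : List (Fin n)) (G H : Finset (Fin n)), w.Nodup →
    (∀ i ∈ w, i ∉ G) → pt t G w H ≠ 0 → G ⊂ H := by
  intro w
  induction w with
  | nil => intro G H _ _ h; exact absurd rfl h
  | cons i w ih =>
    intro G H hn hG h
    rw [List.nodup_cons] at hn
    have hi : G ⊂ insert i G := Finset.ssubset_insert (hG i (by simp))
    rw [pt] at h
    split_ifs at h with h1
    · rw [h1]; exact hi
    · refine hi.trans (ih _ H hn.2 ?_ h)
      intro j hj
      rw [Finset.mem_insert, not_or]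
      exact ⟨fun e => hn.1 (e ▸ hj), hG j (by simp [hj])⟩

lemma cons_cond {i : Fin n} {w : List (Fin n)} {G : Finset (Fin n)} (hn : (i :: w).Nodup)
    (hG : ∀ j ∈ i :: w, j ∉ G) : w.Nodup ∧ (∀ j ∈ w, j ∉ insert i G) ∧ i ∉ G := by
  rw [List.nodup_cons] at hn
  refine ⟨hn.2, ?_, hG i (by simp)⟩
  intro j hj
  rw [Finset.mem_insert, not_or]
  exact ⟨fun e => hn.1 (e ▸ hj), hG j (by simp [hj])⟩

lemma pt_append (t : Fin n → k) : ∀ (w w2 : List (Fin n)) (G H : Finset (Fin n)),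
    (G ∪ w.toFinset).card ≤ H.card → H ≠ G ∪ w.toFinset →
    pt t G (w ++ w2) H = pt t (G ∪ w.toFinset) w2 H := by
  intro w
  induction w with
  | nil => intro w2 G H _ _; simp
  | cons i w ih =>
    intro w2 G H h1 h2
    have e : G ∪ (i :: w).toFinset = insert i G ∪ w.toFinset := by
      ext j; simp
    rw [e] at h1 h2 ⊢
    rw [List.cons_append, pt, if_neg, ih _ _ _ h1 h2]
    rintro rfl
    exact h2 (Finset.eq_of_subset_of_card_le Finset.subset_union_left h1)

lemma pt_last (t : Fin n → k) (w w2 : List (Fin n)) (G : Finset (Fin n)) (j : Fin n)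
    (hj : j ∉ G ∪ w.toFinset) :
    pt t G (w ++ j :: w2) (insert j (G ∪ w.toFinset)) = t j - hd t w2 := by
  rw [pt_append, pt, if_pos rfl]
  · exact Finset.card_le_card (Finset.subset_insert _ _)
  · intro h; exact hj (h ▸ Finset.mem_insert_self _ _)

lemma pt_comp (t : Fin n → k) : ∀ (w : List (Fin n)) (G H H' : Finset (Fin n)), w.Nodup →
    (∀ i ∈ w, i ∉ G) → ¬ H ⊆ H' → ¬ H' ⊆ H → pt t G w H * pt t G w H' = 0 := by
  intro w
  induction w with
  | nil => intro G H H' _ _ _ _; simp [pt]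
  | cons i w ih =>
    intro G H H' hn hG h1 h2
    obtain ⟨a, b, c⟩ := cons_cond hn hG
    have hs := fun K => pt_supp t w (insert i G) K a b
    by_contra hne
    have hl := left_ne_zero_of_mul hne
    have hr := right_ne_zero_of_mul hne
    rw [pt] at hl hr
    split_ifs at hl hr with e1 e2 e2
    · exact h1 (e1.trans e2.symm).le
    · exact h1 (e1 ▸ (hs _ hr).le)
    · exact h2 (e2 ▸ (hs _ hl).le)
    · apply hne
      rw [pt, pt, if_neg e1, if_neg e2]
      exact ih _ H H' a b h1 h2

lemma pt_cons (t : Fin n → k) (i : Fin n) (w : List (Fin n)) (G H : Finset (Fin n))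
    (hn : (i :: w).Nodup) (hG : ∀ j ∈ i :: w, j ∉ G) :
    pt t G (i :: w) H = (if H = insert i G then t i - hd t w else 0) + pt t (insert i G) w H := by
  obtain ⟨a, b, c⟩ := cons_cond hn hG
  rw [pt]
  split_ifs with h
  · have : pt t (insert i G) w H = 0 := by
      by_contra h'
      exact (pt_supp t w _ H a b h').ne h.symm
    rw [this, add_zero]
  · simp

lemma pt_sum (t : Fin n → k) : ∀ (w : List (Fin n)) (G : Finset (Fin n)), w.Nodup →
    (∀ i ∈ w, i ∉ G) → ∑ H, pt t G w H = hd t w := by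
  intro w
  induction w with
  | nil => intro G _ _; simp [pt, hd]
  | cons i w ih =>
    intro G hn hG
    obtain ⟨a, b, c⟩ := cons_cond hn hG
    simp only [pt_cons t i w G _ hn hG, Finset.sum_add_distrib, ih _ a b]
    simp [hd]

lemma pt_lin (t : Fin n → k) : ∀ (w : List (Fin n)) (G : Finset (Fin n)), w.Nodup →
    (∀ i ∈ w, i ∉ G) → ∀ i ∈ w,
    ∑ H ∈ Finset.univ.filter (fun H : Finset (Fin n) => i ∈ H), pt t G w H = t i := by
  intro w
  induction w with
  | nil => intro G _ _ i hi; simp at hi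
  | cons j w ih =>
    intro G hn hG i hi
    obtain ⟨a, b, c⟩ := cons_cond hn hG
    simp only [pt_cons t j w G _ hn hG, Finset.sum_add_distrib]
    rw [Finset.sum_ite_eq']
    by_cases hij : i = j
    · subst hij
      have : ∑ H ∈ Finset.univ.filter (fun H : Finset (Fin n) => i ∈ H), pt t (insert i G) w H
          = ∑ H, pt t (insert i G) w H := by
        apply Finset.sum_subset (Finset.filter_subset _ _)
        intro H _ hH
        by_contra h'
        apply hH
        simpa using (pt_supp t w _ H a b h').le (Finset.mem_insert_self i G)
      rw [this, pt_sum t _ _ a b]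
      simp
    · have hiw : i ∈ w := by simpa [hij] using hi
      rw [ih _ a b i hiw]
      have := hG i hi
      simp [hij, this]

lemma mon_congr {A : Type*} [CommRing A] {x y : Finset (Fin n) → A}
    {l : List (Finset (Fin n) × ℕ)} (h : ∀ p ∈ l, x p.1 = y p.1) : mon x l = mon y l := by
  unfold mon
  congr 1
  apply List.map_congr_left
  intro p hp
  rw [h p hp]

lemma mon_map {A B : Type*} [CommRing A] [CommRing B] (f : A →+* B) (x : Finset (Fin n) → A)
    (l : List (Finset (Fin n) × ℕ)) : f (mon x l) = mon (fun H => f (x H)) l := by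
  unfold mon
  rw [map_list_prod, List.map_map]
  congr 1
  apply List.map_congr_left
  intro p _
  simp

lemma good_mem : ∀ {l : List (Finset (Fin n) × ℕ)} {G : Finset (Fin n)}, Good G l →
    ∀ p ∈ l, G ⊂ p.1 := by
  intro l
  induction l with
  | nil => intro G _ p hp; simp at hp
  | cons q l ih =>
    intro G h p hp
    rcases List.mem_cons.mp hp with rfl | hp
    · exact h.1
    · exact h.1.trans (ih h.2.2.2 p hp)

def hcard : List (Finset (Fin n) × ℕ) → ℕ
  | [] => 0
  | p :: _ => p.1.card

open Polynomial in
theorem indep [IsDomain k] {t : Fin n → k} (ht : Function.Injective t) : ∀ (G : Finset (Fin n))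
    (c : List (Finset (Fin n) × ℕ) →₀ k), (∀ l ∈ c.support, Good G l) →
    (∀ w : List (Fin n), w.Nodup → (∀ i, i ∈ w ↔ i ∉ G) →
      ∑ l ∈ c.support, c l * mon (pt t G w) l = 0) → c = 0 := by
  classical
  intro G
  induction G using downInd with
  | _ G ih =>
  intro c hc hw
  have hnil : ∀ l ∈ c.support, l = [] := by
    by_contra! hex
    have hne : (c.support.filter (fun l => l ≠ [])).Nonempty := by
      obtain ⟨l, h1, h2⟩ := hex
      exact ⟨l, Finset.mem_filter.mpr ⟨h1, h2⟩⟩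
    obtain ⟨m, hm, hmin⟩ := Finset.exists_min_image _ hcard hne
    rw [Finset.mem_filter] at hm
    obtain ⟨hm, hm0⟩ := hm
    obtain ⟨⟨F, a0⟩, l0, rfl⟩ := List.exists_cons_of_ne_nil hm0
    obtain ⟨hGF, ha0, had, hl0⟩ := hc _ hm
    simp only at hGF ha0 had hl0
    have hcase : ∀ l ∈ c.support, (∃ a l', l = (F, a) :: l' ∧ 1 ≤ a ∧ a + G.card < F.card ∧
        Good F l') ∨ (∀ p ∈ l, F.card ≤ p.1.card ∧ p.1 ≠ F) := by
      intro l hl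
      rcases l with _ | ⟨⟨F', a⟩, l'⟩
      · right; simp
      · have h1 := hmin ((F', a) :: l') (by simp [Finset.mem_filter, Finsupp.mem_support_iff.mp hl])
        simp only [hcard] at h1
        obtain ⟨g1, g2, g3, g4⟩ := hc _ hl
        simp only at g1 g2 g3 g4
        by_cases hF : F' = F
        · subst hF; left; exact ⟨a, l', rfl, g2, g3, g4⟩
        · right
          intro p hp
          rcases List.mem_cons.mp hp with rfl | hp
          · exact ⟨h1, hF⟩
          · have := Finset.card_lt_card (good_mem g4 p hp)
            exact ⟨by omega, by rintro rfl; omega⟩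
    have hinj : Function.Injective (fun l' : List (Finset (Fin n) × ℕ) => (F, a0) :: l') :=
      fun a b h => (List.cons.inj h).2
    have hzero := ih F hGF (c.comapDomain (fun l' => (F, a0) :: l') hinj.injOn)
      (by
        intro l hl
        have : (F, a0) :: l ∈ c.support := by simpa using hl
        exact (hc _ this).2.2.2) ?_
    · have := DFunLike.congr_fun hzero l0
      simp at this
      exact (Finsupp.mem_support_iff.mp hm) this
    intro w2 hw2n hw2
    let y : Finset (Fin n) → k[X] := fun H => if H = F then X else C (pt t F w2 H)
    have hy1 : ∀ a l', Good F l' → mon y ((F, a) :: l') = C (mon (pt t F w2) l') * X ^ a := by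
      intro a l' h
      have : mon y l' = C (mon (pt t F w2) l') := by
        rw [mon_map C]
        apply mon_congr
        intro p hp
        simp [y, (good_mem h p hp).ne']
      rw [← this]
      simp [mon, y, mul_comm]
    have hy2 : ∀ l : List (Finset (Fin n) × ℕ), (∀ p ∈ l, F.card ≤ p.1.card ∧ p.1 ≠ F) →
        mon y l = C (mon (pt t F w2) l) := by
      intro l h
      rw [mon_map C]
      apply mon_congr
      intro p hp
      simp [y, (h p hp).2]
    let q : k[X] := ∑ l ∈ c.support, C (c l) * mon y l
    have hdc : (F \ G).card + G.card = F.card := Finset.card_sdiff_add_card_eq_card hGF.le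
    have hdeg : q.degree < ((F \ G).card : ℕ) := by
      rw [Polynomial.degree_lt_iff_coeff_zero]
      intro m hm
      simp only [q, Polynomial.finsetSum_coeff]
      apply Finset.sum_eq_zero
      intro l hl
      rcases hcase l hl with ⟨a, l', rfl, h1, h2, h3⟩ | h
      · rw [hy1 a l' h3, ← mul_assoc, ← C_mul, coeff_C_mul_X_pow, if_neg (by omega)]
      · rw [hy2 l h, ← C_mul, coeff_C, if_neg (by omega)]
    have hroot : ∀ j ∈ F \ G, q.eval (t j - hd t w2) = 0 := by
      intro j hj
      have hjF := (Finset.mem_sdiff.mp hj).1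
      have hjG := (Finset.mem_sdiff.mp hj).2
      let w1 := ((F \ G).erase j).toList
      have hw1 : w1.toFinset = (F \ G).erase j := by simp [w1]
      have hFe : F = insert j (G ∪ w1.toFinset) := by
        rw [hw1]; ext i
        have := @(Finset.ssubset_iff_subset_ne.mp hGF).1 i
        simp only [Finset.mem_insert, Finset.mem_union, Finset.mem_erase, Finset.mem_sdiff]
        by_cases h : i = j
        · subst h; simp [hjF]
        · simp only [h]; tauto
      have hjn : j ∉ G ∪ w1.toFinset := by rw [hw1]; simp [hjG]
      have hmem1 : ∀ i, i ∈ w1 ↔ i ≠ j ∧ i ∈ F ∧ i ∉ G := by intro i; simp [w1]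
      have hwn : (w1 ++ j :: w2).Nodup := by
        rw [List.nodup_append]
        refine ⟨Finset.nodup_toList _, ?_, ?_⟩
        · rw [List.nodup_cons]; exact ⟨fun h => (hw2 j).mp h hjF, hw2n⟩
        · intro a ha b hb hab
          subst hab
          rw [hmem1] at ha
          rcases List.mem_cons.mp hb with h | h
          · exact ha.1 h
          · exact (hw2 a).mp h ha.2.1
      have := hw (w1 ++ j :: w2) hwn (by
        intro i
        have := @(Finset.ssubset_iff_subset_ne.mp hGF).1 i
        simp only [List.mem_append, List.mem_cons, hmem1, hw2]
        by_cases h : i = j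
        · subst h; simp [hjG]
        · simp only [h]; tauto)
      rw [← this]
      simp only [q, Polynomial.eval_finsetSum, eval_mul, eval_C]
      apply Finset.sum_congr rfl
      intro l hl
      congr 1
      rw [← Polynomial.coe_evalRingHom, mon_map]
      apply mon_congr
      intro p hp
      have hp' : p.1 = F ∨ (F.card ≤ p.1.card ∧ p.1 ≠ F) := by
        rcases hcase l hl with ⟨a, l', rfl, h1, h2, h3⟩ | h
        · rcases List.mem_cons.mp hp with rfl | hp
          · left; rfl
          · right
            have := good_mem h3 p hp
            exact ⟨(Finset.card_lt_card this).le, this.ne'⟩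
        · right; exact h p hp
      rcases hp' with hp' | ⟨h1, h2⟩
      · simp only [y, hp', if_true, coe_evalRingHom, eval_X]
        conv_rhs => rw [hFe]
        rw [pt_last t w1 w2 G j hjn]
      · simp only [y, h2, if_false, coe_evalRingHom, eval_C]
        have e : w1 ++ j :: w2 = (w1 ++ [j]) ++ w2 := by simp
        have e2 : F = G ∪ (w1 ++ [j]).toFinset := by
          conv_lhs => rw [hFe]
          ext i; simp
        rw [e, pt_append t _ w2 G p.1 (e2 ▸ h1) (e2 ▸ h2), ← e2]
    have hq : q = 0 := by
      apply Polynomial.eq_zero_of_degree_lt_of_eval_finset_eq_zero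
        ((F \ G).image (fun j => t j - FY.hd t w2))
      · rw [Finset.card_image_of_injective _ (fun a b h => ht (sub_left_injective h))]
        exact hdeg
      · intro z hz
        obtain ⟨j, hj, rfl⟩ := Finset.mem_image.mp hz
        exact hroot j hj
    have hco : q.coeff a0 = 0 := by rw [hq, coeff_zero]
    rw [← hco]
    simp only [q, Polynomial.finsetSum_coeff]
    symm
    rw [Finsupp.comapDomain_support, ← Finset.sum_preimage (fun l' => (F, a0) :: l') c.support hinj.injOn]
    · apply Finset.sum_congr rfl
      intro l hl
      have hl' : (F, a0) :: l ∈ c.support := by simpa using hl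
      rw [hy1 a0 l (hc _ hl').2.2.2, ← mul_assoc, ← C_mul, coeff_C_mul_X_pow, if_pos rfl,
        Finsupp.comapDomain_apply]
    · intro l hl hnot
      rcases hcase l hl with ⟨a, l', rfl, h1, h2, h3⟩ | h
      · rw [hy1 a l' h3, ← mul_assoc, ← C_mul, coeff_C_mul_X_pow, if_neg]
        rintro rfl
        exact hnot ⟨l', rfl⟩
      · rw [hy2 l h, ← C_mul, coeff_C, if_neg (by omega)]
  have h := hw (Gᶜ).toList (Finset.nodup_toList _) (by simp)
  have hsum : ∑ l ∈ c.support, c l * mon (pt t G (Gᶜ).toList) l = c [] := by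
    rw [Finset.sum_eq_single []]
    · simp [mon]
    · intro l hl h; exact absurd (hnil l hl) h
    · intro h; simp [Finsupp.notMem_support_iff.mp h]
  rw [hsum] at h
  ext l
  by_contra hl
  have hl' := hnil l (Finsupp.mem_support_iff.mpr hl)
  rw [hl'] at hl
  exact hl h

end Indep

section Final

def prevG {n k : ℕ} (G : Finset (Fin n)) (F : Fin k → Finset (Fin n)) (i : Fin k) : Finset (Fin n) :=
  if h : 0 < (i : ℕ) then F ⟨(i : ℕ) - 1, Nat.lt_of_le_of_lt (Nat.sub_le _ _) i.isLt⟩ else G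

lemma prevG_succ {n k : ℕ} (G : Finset (Fin n)) (F : Fin (k + 1) → Finset (Fin n)) (i : Fin k) :
    prevG G F i.succ = prevG (F 0) (fun j => F j.succ) i := by
  unfold prevG
  rw [dif_pos (by simp)]
  split_ifs with h
  · congr 1
    ext
    simp
    omega
  · congr 1
    ext
    simp
    omega

lemma good_ofFn {n : ℕ} : ∀ (k : ℕ) (G : Finset (Fin n)) (F : Fin k → Finset (Fin n)) (a : Fin k → ℕ),
    Good G (List.ofFn fun i => (F i, a i)) ↔
      (StrictMono F ∧ (∀ i, G ⊂ F i) ∧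
        ∀ i, 1 ≤ a i ∧ a i + (prevG G F i).card < (F i).card) := by
  intro k
  induction k with
  | zero =>
    intro G F a
    simp only [List.ofFn_zero, Good, true_iff]
    exact ⟨fun i => i.elim0, fun i => i.elim0, fun i => i.elim0⟩
  | succ k ih =>
    intro G F a
    rw [List.ofFn_succ, Good, ih, Fin.forall_fin_succ, Fin.forall_fin_succ]
    simp only [prevG_succ]
    have h0 : prevG G F 0 = G := by simp [prevG]
    rw [h0]
    have hm : StrictMono F ↔ (∀ i : Fin k, F 0 ⊂ F i.succ) ∧ StrictMono (fun i : Fin k => F i.succ) := by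
      constructor
      · intro h
        exact ⟨fun i => h (Fin.succ_pos i), fun i j hij => h (Fin.succ_lt_succ_iff.mpr hij)⟩
      · rintro ⟨h1, h2⟩ i j hij
        induction i using Fin.cases with
        | zero =>
          induction j using Fin.cases with
          | zero => exact absurd hij (lt_irrefl _)
          | succ j => exact h1 j
        | succ i =>
          induction j using Fin.cases with
          | zero => exact absurd hij (by simp)
          | succ j => exact h2 (Fin.succ_lt_succ_iff.mp hij)
    rw [hm]
    constructor
    · rintro ⟨p1, p2, p3, p4, p5, p6⟩
      exact ⟨⟨p5, p4⟩, ⟨p1, fun i => p1.trans (p5 i)⟩, ⟨p2, p3⟩, p6⟩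
    · rintro ⟨⟨p5, p4⟩, ⟨p1, _⟩, ⟨p2, p3⟩, p6⟩
      exact ⟨p1, p2, p3, p4, p5, p6⟩

def toL {n : ℕ} (p : Σ k : ℕ, (Fin k → Finset (Fin n)) × (Fin k → ℕ)) :
    List (Finset (Fin n) × ℕ) := List.ofFn fun i => (p.2.1 i, p.2.2 i)

lemma isFY_iff {n : ℕ} (p : Σ k : ℕ, (Fin k → Finset (Fin n)) × (Fin k → ℕ)) :
    IsFY p ↔ Good ∅ (toL p) := by
  unfold toL
  rw [good_ofFn]
  have : ∀ i, prevG ∅ p.2.1 i = prevSet p.2.1 i := fun i => rfl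
  simp only [this, IsFY]
  constructor
  · rintro ⟨h1, h2⟩
    refine ⟨h1, fun i => ?_, h2⟩
    rw [Finset.empty_ssubset, ← Finset.card_pos]
    have := h2 i
    omega
  · rintro ⟨h1, _, h2⟩
    exact ⟨h1, h2⟩

lemma toL_inj {n : ℕ} : Function.Injective (toL (n := n)) := by
  rintro ⟨k, F, a⟩ ⟨k', F', a'⟩ h
  have h2 := List.ofFn_inj'.mp h
  obtain rfl : k = k' := congrArg Sigma.fst h2
  have h3 := eq_of_heq (Sigma.mk.inj h2).2
  have hF : F = F' := by funext i; exact congrArg Prod.fst (congrFun h3 i)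
  have ha : a = a' := by funext i; exact congrArg Prod.snd (congrFun h3 i)
  rw [hF, ha]

lemma toL_surj {n : ℕ} (l : List (Finset (Fin n) × ℕ)) : ∃ p, toL p = l :=
  ⟨⟨l.length, fun i => (l.get i).1, fun i => (l.get i).2⟩, by simp [toL]⟩

noncomputable def X' {n : ℕ} (H : Finset (Fin n)) :
    MvPolynomial {F : Finset (Fin n) // F.Nonempty} ℚ :=
  if h : H.Nonempty then MvPolynomial.X ⟨H, h⟩ else 1

lemma fyMonomial_eq {n : ℕ} (p : Σ k : ℕ, (Fin k → Finset (Fin n)) × (Fin k → ℕ)) :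
    fyMonomial p = mon X' (toL p) := by
  unfold mon toL
  rw [List.map_ofFn, List.prod_ofFn]
  rfl

lemma sum_sub {n : ℕ} {A : Type*} [AddCommMonoid A] (x : Finset (Fin n) → A) (i : Fin n) :
    ∑ H ∈ Finset.univ.filter (fun H : Finset (Fin n) => i ∈ H), x H =
    ∑ F ∈ Finset.univ.filter (fun F : {F : Finset (Fin n) // F.Nonempty} => i ∈ F.1), x F.1 := by
  symm
  apply Finset.sum_bij (fun F _ => F.1)
  · intro F hF; simpa using hF
  · intro F _ G _ h; exact Subtype.ext h
  · intro H hH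
    have hi : i ∈ H := by simpa using hH
    exact ⟨⟨H, ⟨i, hi⟩⟩, by simpa using hi, rfl⟩
  · intros; rfl

lemma rel_chow (n : ℕ) : Rel (k := ℚ) (fun _ : Fin n => 0)
    (fun H => Ideal.Quotient.mk (chowIdeal n) (X' H)) where
  one := by simp [X']
  inc F G h1 h2 := by
    have hF : F.Nonempty := by
      rw [Finset.nonempty_iff_ne_empty]; rintro rfl; simp at h1
    have hG : G.Nonempty := by
      rw [Finset.nonempty_iff_ne_empty]; rintro rfl; simp at h2
    rw [← map_mul, Ideal.Quotient.eq_zero_iff_mem]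
    apply Ideal.subset_span
    left
    exact ⟨⟨F, hF⟩, ⟨G, hG⟩, h1, h2, by simp [X', hF, hG]⟩
  lin i := by
    rw [sum_sub, map_zero, ← map_sum, Ideal.Quotient.eq_zero_iff_mem]
    apply Ideal.subset_span
    right
    refine ⟨i, Finset.sum_congr rfl fun F _ => ?_⟩
    simp [X', F.2]

lemma span_final (n : ℕ) : Submodule.span ℚ
      (Set.range fun u : FYBn n =>
        Ideal.Quotient.mk (chowIdeal n) (fyMonomial u.1)) = ⊤ := by
  rw [eq_top_iff]
  rintro z -
  have hz : z ∈ Algebra.adjoin ℚ (Set.range fun H : Finset (Fin n) => Ideal.Quotient.mk (chowIdeal n) (X' H)) := by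
    obtain ⟨p, rfl⟩ := Ideal.Quotient.mk_surjective z
    induction p using MvPolynomial.induction_on with
    | C a => exact Subalgebra.algebraMap_mem _ a
    | add p q hp hq => rw [map_add]; exact add_mem hp hq
    | mul_X p F hp =>
      rw [map_mul]
      refine mul_mem hp (Algebra.subset_adjoin ⟨F.1, ?_⟩)
      simp [X', F.2]
  have := span_main (rel_chow n) z hz
  refine Submodule.span_mono ?_ this
  rintro y ⟨l, hl, rfl⟩
  obtain ⟨p, rfl⟩ := toL_surj l
  exact ⟨⟨p, (isFY_iff p).mpr hl⟩, by
    simp only [fyMonomial_eq]; rw [mon_map]⟩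

open Polynomial

noncomputable def tt {n : ℕ} (i : Fin n) : ℚ[X] := C (i : ℚ) * X

lemma tt_inj {n : ℕ} : Function.Injective (tt (n := n)) := by
  intro i j h
  have := congrArg (fun p => p.coeff 1) h
  simp [tt] at this
  exact Fin.ext this

abbrev Wd (n : ℕ) := {w : List (Fin n) // w.Nodup ∧ ∀ i, i ∈ w}

noncomputable def xx {n : ℕ} (H : Finset (Fin n)) : Wd n → ℚ[X] :=
  fun w => if H = ∅ then 1 else pt tt ∅ w.1 H

lemma rel_xx (n : ℕ) : Rel (k := ℚ[X]) (tt (n := n)) (xx (n := n)) where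
  one := by funext w; simp [xx]
  inc F G h1 h2 := by
    have hF : F ≠ ∅ := by rintro rfl; simp at h1
    have hG : G ≠ ∅ := by rintro rfl; simp at h2
    funext w
    simp only [xx, hF, hG, if_false, Pi.mul_apply, Pi.zero_apply]
    exact pt_comp tt w.1 ∅ F G w.2.1 (by simp) h1 h2
  lin i := by
    funext w
    rw [Finset.sum_apply]
    have := pt_lin tt w.1 ∅ w.2.1 (by simp) i (w.2.2 i)
    rw [Pi.algebraMap_apply, Algebra.algebraMap_self, RingHom.id_apply, ← this]
    apply Finset.sum_congr rfl
    intro H hH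
    have hi : i ∈ H := by simpa using hH
    have : H ≠ ∅ := by rintro rfl; simp at hi
    simp [xx, this]

noncomputable def phi (n : ℕ) :
    MvPolynomial {F : Finset (Fin n) // F.Nonempty} ℚ →ₐ[ℚ] (Wd n → ℚ[X]) :=
  MvPolynomial.aeval (fun F => xx F.1)

lemma phi_X' {n : ℕ} (H : Finset (Fin n)) : phi n (X' H) = xx H := by
  unfold X'
  split_ifs with h
  · simp [phi]
  · rw [Finset.not_nonempty_iff_eq_empty] at h
    rw [map_one, h, (rel_xx n).one]

lemma phi_mem {n : ℕ} (p) : phi n p ∈ Algebra.adjoin ℚ[X] (Set.range (xx (n := n))) := by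
  induction p using MvPolynomial.induction_on with
  | C a =>
    have : phi n (MvPolynomial.C a) = algebraMap ℚ[X] (Wd n → ℚ[X]) (C a) := by
      funext w; simp [phi]
    rw [this]
    exact Subalgebra.algebraMap_mem _ _
  | add p q hp hq => rw [map_add]; exact add_mem hp hq
  | mul_X p F hp =>
    rw [map_mul]
    refine mul_mem hp (Algebra.subset_adjoin ⟨F.1, ?_⟩)
    simp [phi]

lemma phi_chow {n : ℕ} (f) (hf : f ∈ chowIdeal n) :
    ∃ g ∈ Algebra.adjoin ℚ[X] (Set.range (xx (n := n))), phi n f = (X : ℚ[X]) • g := by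
  unfold chowIdeal at hf
  induction hf using Submodule.span_induction with
  | mem f hf =>
    rcases hf with ⟨F, G, h1, h2, rfl⟩ | ⟨i, rfl⟩
    · refine ⟨0, zero_mem _, ?_⟩
      rw [map_mul, smul_zero]
      simpa [phi] using (rel_xx n).inc F.1 G.1 h1 h2
    · refine ⟨algebraMap ℚ[X] _ (C (i : ℚ)), Subalgebra.algebraMap_mem _ _, ?_⟩
      have := (rel_xx n).lin i
      rw [sum_sub] at this
      rw [map_sum]
      simp only [phi, MvPolynomial.aeval_X]
      rw [this, Algebra.smul_def, ← map_mul, tt, mul_comm]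
  | zero => exact ⟨0, zero_mem _, by simp⟩
  | add f g _ _ hf hg =>
    obtain ⟨u, hu, e⟩ := hf
    obtain ⟨v, hv, e'⟩ := hg
    exact ⟨u + v, add_mem hu hv, by rw [map_add, e, e', smul_add]⟩
  | smul p f _ hf =>
    obtain ⟨u, hu, e⟩ := hf
    exact ⟨phi n p * u, mul_mem (phi_mem p) hu, by
      rw [smul_eq_mul, map_mul, e, mul_smul_comm]⟩

lemma indep_final (n : ℕ) : LinearIndependent ℚ
      (fun u : FYBn n => Ideal.Quotient.mk (chowIdeal n) (fyMonomial u.1)) := by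
  rw [linearIndependent_iff]
  intro c hc
  have hf : (∑ u ∈ c.support, c u • fyMonomial u.1) ∈ chowIdeal n := by
    rw [← Ideal.Quotient.eq_zero_iff_mem, map_sum, ← hc, Finsupp.linearCombination_apply]
    rfl
  obtain ⟨g, hg, e⟩ := phi_chow _ hf
  have hg' := span_main (rel_xx n) g hg
  have hW : W ℚ[X] (xx (n := n)) ∅ = Submodule.span ℚ[X] (Set.image (mon xx) {l | Good ∅ l}) := by
    unfold W
    congr 1
    ext y
    simp [Set.mem_image, eq_comm]
  rw [hW, Finsupp.mem_span_image_iff_linearCombination] at hg'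
  obtain ⟨b, hb, rfl⟩ := hg'
  rw [Finsupp.mem_supported] at hb
  let f0 : FYBn n → List (Finset (Fin n) × ℕ) := fun u => toL u.1
  have hf0 : Function.Injective f0 := fun u v h => Subtype.ext (toL_inj h)
  let c1 : FYBn n →₀ ℚ[X] := c.mapRange C (map_zero _)
  let c' : List (Finset (Fin n) × ℕ) →₀ ℚ[X] := c1.mapDomain f0 - (X : ℚ[X]) • b
  have hgood : ∀ l ∈ c'.support, Good ∅ l := by
    classical
    intro l hl
    rcases Finset.mem_union.mp (Finsupp.support_sub hl) with h | h
    · obtain ⟨u, -, rfl⟩ := Finset.mem_image.mp (Finsupp.mapDomain_support h)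
      exact (isFY_iff _).mp u.2
    · exact hb (Finsupp.support_smul h)
  have hsum : Finsupp.linearCombination ℚ[X] (mon (xx (n := n))) c' = 0 := by
    rw [map_sub, map_smul, ← e, Finsupp.linearCombination_mapDomain, sub_eq_zero, map_sum,
      Finsupp.linearCombination_apply]
    simp only [c1]
    rw [Finsupp.sum_mapRange_index (by simp), Finsupp.sum]
    apply Finset.sum_congr rfl
    intro u _
    rw [map_smul, fyMonomial_eq]
    have : phi n (mon X' (toL u.1)) = mon xx (toL u.1) := by
      have := mon_map (phi n).toRingHom X' (toL u.1)
      refine this.trans ?_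
      exact mon_congr fun p _ => phi_X' p.1
    rw [this]
    funext w
    simp [f0, Polynomial.smul_eq_C_mul]
  have h0 : c' = 0 := by
    apply indep tt_inj ∅ c' hgood
    intro w hw1 hw2
    have := congrFun hsum ⟨w, hw1, fun i => (hw2 i).mpr (by simp)⟩
    rw [Finsupp.linearCombination_apply, Finsupp.sum, Finset.sum_apply] at this
    rw [Pi.zero_apply] at this
    rw [← this]
    apply Finset.sum_congr rfl
    intro l hl
    rw [Pi.smul_apply, smul_eq_mul]
    congr 1
    have hev := mon_map (Pi.evalRingHom (fun _ : Wd n => ℚ[X]) ⟨w, hw1, fun i => (hw2 i).mpr (by simp)⟩) xx l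
    rw [Pi.evalRingHom_apply] at hev
    rw [hev]
    apply mon_congr
    intro p hp
    have hne : p.1 ≠ ∅ := (good_mem (hgood l hl) p hp).ne'
    simp [xx, hne]
  ext u
  have h1 := DFunLike.congr_fun h0 (f0 u)
  simp only [c', Finsupp.sub_apply, Finsupp.mapDomain_apply hf0, c1, Finsupp.mapRange_apply,
    Finsupp.smul_apply, Finsupp.zero_apply, smul_eq_mul] at h1
  have h2 := congrArg (fun p => p.coeff 0) h1
  simpa using h2

end Final

end FY

theorem stmt18 (n : ℕ) :
    LinearIndependent ℚ
      (fun u : FYBn n => Ideal.Quotient.mk (chowIdeal n) (fyMonomial u.1)) ∧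
    Submodule.span ℚ
      (Set.range fun u : FYBn n =>
        Ideal.Quotient.mk (chowIdeal n) (fyMonomial u.1)) = ⊤ :=
  ⟨FY.indep_final n, FY.span_final n⟩
end

section
/- The Hilbert series of the Chow ring of the Boolean matroid B_n (graded by degree) is the Eulerian polynomial: Σ_j dim_ℚ A^j(B_n) t^j = A_n(t); in particular dim_ℚ A(B_n) = n!. -/
open Finset

/-- Nonempty subsets of `Fin n`. -/
abbrev NE (n : ℕ) := {F : Finset (Fin n) // F.Nonempty}

/-- `i` is a descent position of `σ`. -/
def IsDes {n : ℕ} (σ : Equiv.Perm (Fin n)) (i : Fin n) : Prop :=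
  ∃ h : (i : ℕ) + 1 < n, σ ⟨(i : ℕ) + 1, h⟩ < σ i

/-- The initial segment `{σ 0, …, σ i}`. -/
def seg {n : ℕ} (σ : Equiv.Perm (Fin n)) (i : Fin n) : NE n :=
  ⟨Finset.univ.filter (fun x => σ.symm x ≤ i), ⟨σ i, by simp⟩⟩

lemma mem_seg {n : ℕ} {σ : Equiv.Perm (Fin n)} {i x : Fin n} :
    x ∈ (seg σ i).1 ↔ σ.symm x ≤ i := by simp [seg]

lemma apply_mem_seg {n : ℕ} {σ : Equiv.Perm (Fin n)} {i j : Fin n} :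
    σ j ∈ (seg σ i).1 ↔ j ≤ i := by simp [seg]

lemma card_seg {n : ℕ} (σ : Equiv.Perm (Fin n)) (i : Fin n) :
    (seg σ i).1.card = (i : ℕ) + 1 := by
  have : (seg σ i).1 = (Finset.Iic i).map σ.toEmbedding := by
    ext x
    rw [mem_seg]
    simp only [Finset.mem_map, Finset.mem_Iic, Equiv.coe_toEmbedding]
    constructor
    · intro h; exact ⟨_, h, by simp⟩
    · rintro ⟨a, h, rfl⟩; simpa using h
  rw [this, Finset.card_map, Fin.card_Iic]

lemma seg_injective {n : ℕ} (σ : Equiv.Perm (Fin n)) : Function.Injective (seg σ) := by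
  intro i j h
  have := card_seg σ i
  rw [h, card_seg] at this
  exact Fin.ext (by omega)

lemma seg_eq_seg {n : ℕ} {σ τ : Equiv.Perm (Fin n)} {i j : Fin n} (h : seg σ i = seg τ j) :
    i = j := by
  have := card_seg σ i
  rw [h, card_seg] at this
  exact Fin.ext (by omega)

/-- Existence of a descent between two positions. -/
lemma exists_des {n : ℕ} (σ : Equiv.Perm (Fin n)) (a b : Fin n) (hab : a < b)
    (h : σ b < σ a) : ∃ i, IsDes σ i ∧ a ≤ i ∧ i < b := by
  by_contra hc
  push Not at hc
  have key : ∀ k : ℕ, ∀ hk : (a : ℕ) + k < n, (a : ℕ) + k ≤ b → σ a ≤ σ ⟨a + k, hk⟩ := by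
    intro k
    induction k with
    | zero => intro hk _; simp
    | succ k ih =>
      intro hk hkb
      have h1 := ih (by omega) (by omega)
      refine h1.trans ?_
      by_contra h2
      have := hc ⟨a + k, by omega⟩ ⟨by simpa [add_assoc] using hk, by
        simpa [add_assoc] using h2⟩ (by simp [Fin.le_def])
      simp [Fin.le_def] at this
      omega
  have hab' : (a : ℕ) < b := hab
  have := key (b - a) (by omega) (by omega)
  have e : (⟨(a : ℕ) + (b - a), by omega⟩ : Fin n) = b := Fin.ext (by simp; omega)
  rw [e] at this
  exact absurd h (not_lt.mpr this)

/-- Lexicographic key of a permutation. -/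
def key {n : ℕ} (σ : Equiv.Perm (Fin n)) : Lex (Fin n → Fin n) := toLex (fun i => σ i)

lemma key_injective {n : ℕ} : Function.Injective (key (n := n)) := by
  intro σ τ h
  ext i
  have : σ i = τ i := congrFun (toLex.injective h) i
  rw [this]

lemma key_le {n : ℕ} {σ τ : Equiv.Perm (Fin n)}
    (h : ∀ i, IsDes σ i → ∃ j, seg σ i = seg τ j) : key σ ≤ key τ := by
  by_contra hc
  rw [not_le] at hc
  obtain ⟨a, ha, hlt⟩ := hc
  have ha' : ∀ j < a, τ j = σ j := ha
  have hlt' : τ a < σ a := hlt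
  obtain ⟨b, hb⟩ := σ.surjective (τ a)
  have hab : a < b := by
    rcases lt_trichotomy a b with h1 | h1 | h1
    · exact h1
    · subst h1; rw [hb] at hlt'; exact absurd hlt' (lt_irrefl _)
    · have := ha' b h1
      rw [hb] at this
      exact absurd (τ.injective this) h1.ne
  obtain ⟨i, hi, hai, hib⟩ := exists_des σ a b hab (by rw [hb]; exact hlt')
  obtain ⟨j, hj⟩ := h i hi
  have hij := seg_eq_seg hj
  subst hij
  have h1 : τ a ∈ (seg τ i).1 := apply_mem_seg.2 hai
  rw [← hj, ← hb, apply_mem_seg] at h1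
  exact absurd hib (not_lt.mpr h1)

/-- Every chain of nonempty sets sits between the descent set and the full chain of some
permutation. -/
lemma exists_perm {n : ℕ} (C : Finset (NE n)) (hC : ∀ F ∈ C, ∀ G ∈ C, F.1 ⊆ G.1 ∨ G.1 ⊆ F.1) :
    ∃ τ : Equiv.Perm (Fin n), (∀ i, IsDes τ i → seg τ i ∈ C) ∧ ∀ F ∈ C, ∃ i, F = seg τ i := by
  classical
  let r : Fin n → ℕ := fun x => (C.filter (fun G => x ∉ G.1)).card
  have hr : ∀ G ∈ C, ∀ x y, r x ≤ r y → y ∈ G.1 → x ∈ G.1 := by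
    intro G hG x y hxy hy
    by_contra hx
    have : C.filter (fun H => y ∉ H.1) ⊂ C.filter (fun H => x ∉ H.1) := by
      rw [Finset.ssubset_iff_of_subset]
      · exact ⟨G, by simp [hG, hx], by simp [hy]⟩
      · intro H hH
        rw [Finset.mem_filter] at hH ⊢
        refine ⟨hH.1, fun hxH => ?_⟩
        rcases hC H hH.1 G hG with h | h
        · exact hx (h hxH)
        · exact hH.2 (h hy)
    exact absurd (Finset.card_lt_card this) (not_lt.mpr hxy)
  obtain ⟨hmono, hst⟩ := (Tuple.eq_sort_iff (f := r) (σ := Tuple.sort r)).1 rfl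
  set τ := Tuple.sort r
  refine ⟨τ, ?_, ?_⟩
  · rintro i ⟨h, hi⟩
    have hlt : i < (⟨(i : ℕ) + 1, h⟩ : Fin n) := by simp [Fin.lt_def]
    have h1 : r (τ i) ≤ r (τ ⟨(i : ℕ) + 1, h⟩) := hmono hlt.le
    have h2 : r (τ i) ≠ r (τ ⟨(i : ℕ) + 1, h⟩) := fun he => absurd (hst _ _ hlt he) hi.not_gt
    have h3 : ∃ G ∈ C, τ ⟨(i : ℕ) + 1, h⟩ ∉ G.1 ∧ τ i ∈ G.1 := by
      by_contra hc
      push Not at hc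
      have : r (τ ⟨(i : ℕ) + 1, h⟩) ≤ r (τ i) := by
        apply Finset.card_le_card
        intro G hG
        rw [Finset.mem_filter] at hG ⊢
        exact ⟨hG.1, hc G hG.1 hG.2⟩
      omega
    obtain ⟨G, hG, hG1, hG2⟩ := h3
    have : seg τ i = G := by
      apply Subtype.ext
      ext x
      obtain ⟨j, rfl⟩ := τ.surjective x
      rw [apply_mem_seg]
      constructor
      · intro hj; exact hr G hG _ _ (hmono hj) hG2
      · intro hj
        by_contra hji
        rw [not_le] at hji
        exact hG1 (hr G hG _ _ (hmono (show (⟨(i : ℕ) + 1, h⟩ : Fin n) ≤ j from hji)) hj)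
    rw [this]; exact hG
  · intro G hG
    have hne : (G.1.image τ.symm).Nonempty := G.2.image _
    refine ⟨(G.1.image τ.symm).max' hne, Subtype.ext ?_⟩
    ext x
    rw [mem_seg]
    constructor
    · intro hx; exact Finset.le_max' _ _ (Finset.mem_image_of_mem _ hx)
    · intro hx
      obtain ⟨y, hy, hy2⟩ := Finset.mem_image.1 (Finset.max'_mem _ hne)
      rw [← hy2] at hx
      have := hmono hx
      simp only [Function.comp, Equiv.apply_symm_apply] at this
      exact hr G hG _ _ this hy

open Classical in
/-- The set of initial segments at descents. -/
noncomputable def Rset {n : ℕ} (σ : Equiv.Perm (Fin n)) : Finset (NE n) :=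
  (Finset.univ.filter (fun i => IsDes σ i)).image (seg σ)

lemma mem_Rset {n : ℕ} {σ : Equiv.Perm (Fin n)} {F : NE n} :
    F ∈ Rset σ ↔ ∃ i, IsDes σ i ∧ seg σ i = F := by
  classical
  simp [Rset]

lemma card_Rset {n : ℕ} (σ : Equiv.Perm (Fin n)) : (Rset σ).card = des σ := by
  classical
  rw [Rset, Finset.card_image_of_injective _ (seg_injective σ), des, Nat.card_eq_fintype_card,
    Fintype.card_subtype]
  congr 1
  ext i
  rw [Finset.mem_filter, Finset.mem_filter]
  rfl

/-- The descent monomial. -/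
noncomputable def eta {n : ℕ} (σ : Equiv.Perm (Fin n)) : MvPolynomial (NE n) ℚ :=
  ∏ G ∈ Rset σ, MvPolynomial.X G

/-- The linear forms. -/
noncomputable def theta {n : ℕ} (i : Fin n) : MvPolynomial (NE n) ℚ :=
  ∑ F ∈ Finset.univ.filter (fun F : NE n => i ∈ F.1), MvPolynomial.X F

/-- The Stanley-Reisner ideal. -/
noncomputable def srIdeal (n : ℕ) : Ideal (MvPolynomial (NE n) ℚ) :=
  Ideal.span {q | ∃ F G : NE n,
        ¬ F.1 ⊆ G.1 ∧ ¬ G.1 ⊆ F.1 ∧ q = MvPolynomial.X F * MvPolynomial.X G}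

lemma chowIdeal_eq (n : ℕ) :
    chowIdeal n = srIdeal n ⊔ Ideal.span (Set.range (theta (n := n))) := by
  rw [chowIdeal, Ideal.span_union, srIdeal]
  congr 2
  ext q
  simp only [Set.mem_ofPred_eq, Set.mem_range, theta]
  exact exists_congr fun i => eq_comm

/-- Evaluation of polynomials at the linear forms. -/
noncomputable def evTheta (n : ℕ) : MvPolynomial (Fin n) ℚ →ₐ[ℚ] MvPolynomial (NE n) ℚ :=
  MvPolynomial.aeval theta

/-- Combinations of descent monomials with coefficients polynomials in `theta`. -/
noncomputable def comb {n : ℕ} (p : Equiv.Perm (Fin n) → MvPolynomial (Fin n) ℚ) :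
    MvPolynomial (NE n) ℚ := ∑ σ, evTheta n (p σ) * eta σ

/-- Being a combination modulo the Stanley-Reisner ideal. -/
def InM {n : ℕ} (q : MvPolynomial (NE n) ℚ) : Prop := ∃ p, q - comb p ∈ srIdeal n

lemma InM.add {n : ℕ} {q r : MvPolynomial (NE n) ℚ} (hq : InM q) (hr : InM r) :
    InM (q + r) := by
  obtain ⟨p, hp⟩ := hq
  obtain ⟨s, hs⟩ := hr
  refine ⟨p + s, ?_⟩
  have : q + r - comb (p + s) = (q - comb p) + (r - comb s) := by
    simp [comb, add_mul, Finset.sum_add_distrib]; ring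
  rw [this]
  exact Ideal.add_mem _ hp hs

lemma InM.mul {n : ℕ} {q : MvPolynomial (NE n) ℚ} (f : MvPolynomial (Fin n) ℚ) (hq : InM q) :
    InM (evTheta n f * q) := by
  obtain ⟨p, hp⟩ := hq
  refine ⟨fun σ => f * p σ, ?_⟩
  have : evTheta n f * q - comb (fun σ => f * p σ) = evTheta n f * (q - comb p) := by
    simp [comb, mul_sub, Finset.mul_sum, mul_assoc]
  rw [this]
  exact Ideal.mul_mem_left _ _ hp

lemma InM.neg {n : ℕ} {q : MvPolynomial (NE n) ℚ} (hq : InM q) : InM (-q) := by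
  have := hq.mul (-1)
  simpa using this

lemma InM.theta_mul {n : ℕ} {q : MvPolynomial (NE n) ℚ} (i : Fin n) (hq : InM q) :
    InM (theta i * q) := by
  have := hq.mul (MvPolynomial.X i)
  simpa [evTheta] using this

lemma InM.of_mem {n : ℕ} {q : MvPolynomial (NE n) ℚ} (hq : q ∈ srIdeal n) : InM q :=
  ⟨0, by simpa [comb] using hq⟩

lemma InM.sum {n : ℕ} {ι : Type*} (s : Finset ι) (f : ι → MvPolynomial (NE n) ℚ)
    (h : ∀ i ∈ s, InM (f i)) : InM (∑ i ∈ s, f i) := by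
  classical
  induction s using Finset.induction_on with
  | empty => exact InM.of_mem (by simp)
  | insert a s ha ih =>
    rw [Finset.sum_insert ha]
    exact (h _ (by simp)).add (ih fun i hi => h i (by simp [hi]))

lemma InM.eta {n : ℕ} (σ : Equiv.Perm (Fin n)) : InM (eta σ) := by
  classical
  refine ⟨Pi.single σ 1, ?_⟩
  have : comb (Pi.single σ 1) = _root_.eta σ := by
    rw [comb, Finset.sum_eq_single σ]
    · simp
    · intro τ _ h; simp [Pi.single_eq_of_ne h]
    · simp
  simp [this]

/-- Multiplying a descent monomial by a variable off the chain. -/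
lemma eta_mul_X {n : ℕ} (σ : Equiv.Perm (Fin n)) (F : NE n) (hF : ∀ i, F ≠ seg σ i) :
    eta σ * MvPolynomial.X F ∈ srIdeal n ∨
      ∃ τ, key σ < key τ ∧ eta τ ∣ eta σ * MvPolynomial.X F := by
  classical
  have hFR : F ∉ Rset σ := by
    rw [mem_Rset]; rintro ⟨i, -, h⟩; exact hF i h.symm
  by_cases hc : ∃ G ∈ Rset σ, ¬ F.1 ⊆ G.1 ∧ ¬ G.1 ⊆ F.1
  · left
    obtain ⟨G, hG, h1, h2⟩ := hc
    rw [eta, ← Finset.mul_prod_erase _ _ hG]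
    have : MvPolynomial.X F * MvPolynomial.X G ∈ srIdeal n :=
      Ideal.subset_span ⟨F, G, h1, h2, rfl⟩
    have h3 := Ideal.mul_mem_left _ (∏ x ∈ (Rset σ).erase G, MvPolynomial.X x) this
    convert! h3 using 1
    ring
  · right
    push Not at hc
    obtain ⟨τ, h1, h2⟩ := exists_perm (insert F (Rset σ)) (by
      have hRR : ∀ G ∈ Rset σ, ∀ H ∈ Rset σ, G.1 ⊆ H.1 ∨ H.1 ⊆ G.1 := by
        intro G hG H hH
        obtain ⟨i, -, rfl⟩ := mem_Rset.1 hG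
        obtain ⟨j, -, rfl⟩ := mem_Rset.1 hH
        rcases le_total i j with h | h
        · left; intro x hx; rw [mem_seg] at hx ⊢; exact hx.trans h
        · right; intro x hx; rw [mem_seg] at hx ⊢; exact hx.trans h
      intro G hG H hH
      rw [Finset.mem_insert] at hG hH
      rcases hG with rfl | hG <;> rcases hH with rfl | hH
      · left; exact subset_rfl
      · by_cases h : G.1 ⊆ H.1
        · exact Or.inl h
        · exact Or.inr (hc H hH h)
      · by_cases h : H.1 ⊆ G.1
        · exact Or.inr h
        · exact Or.inl (hc G hG h)
      · exact hRR G hG H hH)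
    refine ⟨τ, lt_of_le_of_ne ?_ ?_, ?_⟩
    · apply key_le
      intro i hi
      exact h2 _ (Finset.mem_insert_of_mem (mem_Rset.2 ⟨i, hi, rfl⟩))
    · intro he
      have := key_injective he
      subst this
      obtain ⟨i, hi⟩ := h2 F (Finset.mem_insert_self _ _)
      exact hF i hi
    · have : eta σ * MvPolynomial.X F = ∏ G ∈ insert F (Rset σ), MvPolynomial.X G := by
        rw [Finset.prod_insert hFR, eta, mul_comm]
      rw [this, eta]
      apply Finset.prod_dvd_prod_of_subset
      intro G hG
      obtain ⟨i, hi, rfl⟩ := mem_Rset.1 hG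
      exact h1 i hi

lemma theta_eq {n : ℕ} (σ : Equiv.Perm (Fin n)) (i : Fin n) :
    ∃ s : MvPolynomial (Fin n) ℚ, ∃ c : NE n → ℚ, (∀ j, c (seg σ j) = 0) ∧
      MvPolynomial.X (seg σ i) = evTheta n s + ∑ F, MvPolynomial.C (c F) * MvPolynomial.X F := by
  classical
  have hth : ∀ j : Fin n, theta j = ∑ F : NE n, MvPolynomial.C (if j ∈ F.1 then 1 else 0) *
      MvPolynomial.X F := by
    intro j
    rw [theta, Finset.sum_filter]
    apply Finset.sum_congr rfl
    intro F _
    split_ifs <;> simp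
  have hX : (MvPolynomial.X (seg σ i) : MvPolynomial (NE n) ℚ) =
      ∑ F : NE n, MvPolynomial.C (if F = seg σ i then 1 else 0) * MvPolynomial.X F := by
    rw [Finset.sum_eq_single (seg σ i)] <;> simp +contextual
  by_cases h : (i : ℕ) + 1 < n
  · refine ⟨MvPolynomial.X (σ i) - MvPolynomial.X (σ ⟨i + 1, h⟩),
      fun F => (if F = seg σ i then 1 else 0) - (if σ i ∈ F.1 then 1 else 0) +
        (if σ ⟨i + 1, h⟩ ∈ F.1 then 1 else 0), ?_, ?_⟩
    · intro j
      simp only [apply_mem_seg, (seg_injective σ).eq_iff, Fin.le_def, Fin.ext_iff]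
      split_ifs <;> first | omega | norm_num
    · simp only [evTheta, map_sub, MvPolynomial.aeval_X]
      rw [hth, hth, hX, ← Finset.sum_sub_distrib, ← Finset.sum_add_distrib]
      apply Finset.sum_congr rfl
      intro F _
      simp only [map_add, map_sub]
      ring
  · refine ⟨MvPolynomial.X (σ i),
      fun F => (if F = seg σ i then 1 else 0) - (if σ i ∈ F.1 then 1 else 0), ?_, ?_⟩
    · intro j
      simp only [apply_mem_seg, (seg_injective σ).eq_iff, Fin.le_def, Fin.ext_iff]
      split_ifs <;> first | omega | norm_num
    · simp only [evTheta, MvPolynomial.aeval_X]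
      rw [hth, hX, ← Finset.sum_add_distrib]
      apply Finset.sum_congr rfl
      intro F _
      simp only [map_sub]
      ring

lemma InM.eta_mul {n : ℕ} (k : Lex (Fin n → Fin n)) : ∀ σ : Equiv.Perm (Fin n), key σ = k →
    ∀ q, InM (_root_.eta σ * q) := by
  induction k using WellFoundedGT.induction with
  | ind k ih =>
  intro σ hσ q
  have hoff : ∀ F : NE n, (∀ i, F ≠ seg σ i) → ∀ q, InM (_root_.eta σ * q * MvPolynomial.X F) := by
    intro F hF q
    rcases eta_mul_X σ F hF with h | ⟨τ, hτ, r, hr⟩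
    · apply InM.of_mem
      have := Ideal.mul_mem_left _ q h
      convert! this using 1
      ring
    · have := ih (key τ) (hσ ▸ hτ) τ rfl (r * q)
      convert! this using 1
      rw [← mul_assoc, ← hr]
      ring
  induction q using MvPolynomial.induction_on with
  | C a =>
    have := (InM.eta σ).mul (MvPolynomial.C a)
    simpa [evTheta, mul_comm, MvPolynomial.algebraMap_eq] using this
  | add p q hp hq => rw [mul_add]; exact hp.add hq
  | mul_X q F hq =>
    rw [← mul_assoc]
    by_cases hF : ∃ i, F = seg σ i
    · obtain ⟨i, rfl⟩ := hF
      obtain ⟨s, c, hc, he⟩ := theta_eq σ i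
      rw [he, mul_add, Finset.mul_sum]
      refine InM.add ?_ (InM.sum _ _ fun F _ => ?_)
      · rw [mul_comm]; exact hq.mul s
      · by_cases hF : ∃ j, F = seg σ j
        · obtain ⟨j, rfl⟩ := hF
          rw [hc]; exact InM.of_mem (by simp)
        · push Not at hF
          have := hoff F hF (MvPolynomial.C (c F) * q)
          convert! this using 1
          ring
    · push Not at hF
      exact hoff F hF q

lemma eta_one {n : ℕ} : eta (1 : Equiv.Perm (Fin n)) = 1 := by
  have : Rset (1 : Equiv.Perm (Fin n)) = ∅ := by
    rw [Finset.eq_empty_iff_forall_notMem]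
    intro F hF
    obtain ⟨i, ⟨h, hi⟩, -⟩ := mem_Rset.1 hF
    simp [Fin.lt_def] at hi
  simp [eta, this]

lemma InM.all {n : ℕ} (q : MvPolynomial (NE n) ℚ) : InM q := by
  have := InM.eta_mul _ 1 rfl q
  rwa [eta_one, one_mul] at this

/-- Elements of the Chow ideal have expansions with vanishing constant coefficients. -/
lemma chow_expand {n : ℕ} {q : MvPolynomial (NE n) ℚ} (hq : q ∈ chowIdeal n) :
    ∃ p : Equiv.Perm (Fin n) → MvPolynomial (Fin n) ℚ,
      (∀ σ, MvPolynomial.constantCoeff (p σ) = 0) ∧ q - comb p ∈ srIdeal n := by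
  rw [chowIdeal_eq, Submodule.mem_sup] at hq
  obtain ⟨a, ha, b, hb, rfl⟩ := hq
  rw [Ideal.mem_span_range_iff_exists_fun] at hb
  obtain ⟨c, rfl⟩ := hb
  choose p hp using fun i => InM.all (c i)
  refine ⟨fun σ => ∑ i, MvPolynomial.X i * p i σ, fun σ => by simp, ?_⟩
  have : a + ∑ i, c i * theta i - comb (fun σ => ∑ i, MvPolynomial.X i * p i σ) =
      a + ∑ i, theta i * (c i - comb (p i)) := by
    simp only [comb, map_sum, map_mul, evTheta, MvPolynomial.aeval_X, mul_sub,
      Finset.sum_sub_distrib, Finset.sum_mul, Finset.mul_sum]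
    rw [Finset.sum_comm, add_sub_assoc]
    simp only [mul_assoc, mul_comm (c _)]
  rw [this]
  exact Ideal.add_mem _ ha (Ideal.sum_mem _ fun i _ => Ideal.mul_mem_left _ _ (hp i))

/-- The coordinates of the localization at `τ`. -/
noncomputable def locT {n : ℕ} (τ : Equiv.Perm (Fin n)) (k : ℕ) : MvPolynomial (Fin n) ℚ :=
  if h : k < n then MvPolynomial.X (τ ⟨k, h⟩) else 0

open Classical in
/-- The localization at `τ`. -/
noncomputable def loc {n : ℕ} (τ : Equiv.Perm (Fin n)) :
    MvPolynomial (NE n) ℚ →ₐ[ℚ] MvPolynomial (Fin n) ℚ :=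
  MvPolynomial.aeval fun F => if ∃ i, F = seg τ i then
    locT τ (F.1.card - 1) - locT τ F.1.card else 0

lemma loc_X_seg {n : ℕ} (τ : Equiv.Perm (Fin n)) (i : Fin n) :
    loc τ (MvPolynomial.X (seg τ i)) = locT τ i - locT τ (i + 1) := by
  rw [loc, MvPolynomial.aeval_X, if_pos ⟨i, rfl⟩, card_seg]
  rfl

lemma loc_X_of_not {n : ℕ} (τ : Equiv.Perm (Fin n)) (F : NE n) (h : ∀ i, F ≠ seg τ i) :
    loc τ (MvPolynomial.X F) = 0 := by
  rw [loc, MvPolynomial.aeval_X, if_neg (by push Not; exact h)]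

lemma loc_X_seg_ne {n : ℕ} (τ : Equiv.Perm (Fin n)) (i : Fin n) :
    loc τ (MvPolynomial.X (seg τ i)) ≠ 0 := by
  rw [loc_X_seg, locT, dif_pos i.2, locT]
  split_ifs with h
  · rw [sub_ne_zero]
    intro he
    have := τ.injective (MvPolynomial.X_injective he)
    simp [Fin.ext_iff] at this
  · rw [sub_zero]; exact MvPolynomial.X_ne_zero _

lemma loc_sr {n : ℕ} (τ : Equiv.Perm (Fin n)) {q : MvPolynomial (NE n) ℚ} (hq : q ∈ srIdeal n) :
    loc τ q = 0 := by
  have : srIdeal n ≤ RingHom.ker (loc τ) := by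
    rw [srIdeal, Ideal.span_le]
    rintro q ⟨F, G, h1, h2, rfl⟩
    rw [SetLike.mem_coe, RingHom.mem_ker, map_mul]
    by_cases hF : ∃ i, F = seg τ i
    · by_cases hG : ∃ i, G = seg τ i
      · exfalso
        obtain ⟨i, rfl⟩ := hF
        obtain ⟨j, rfl⟩ := hG
        rcases le_total i j with h | h
        · apply h1; intro x hx; rw [mem_seg] at hx ⊢; exact hx.trans h
        · apply h2; intro x hx; rw [mem_seg] at hx ⊢; exact hx.trans h
      · push Not at hG
        rw [loc_X_of_not τ G hG, mul_zero]
    · push Not at hF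
      rw [loc_X_of_not τ F hF, zero_mul]
  exact this hq

lemma locT_sum {n : ℕ} (τ : Equiv.Perm (Fin n)) (k : ℕ) (hk : k ≤ n) :
    ∑ i ∈ Finset.Ico k n, (locT τ i - locT τ (i + 1)) = locT τ k := by
  have h0 : locT τ n = 0 := by simp [locT]
  have := Finset.sum_Ico_sub (locT τ) hk
  have h2 : ∑ i ∈ Finset.Ico k n, (locT τ i - locT τ (i + 1)) =
     -∑ i ∈ Finset.Ico k n, (locT τ (i + 1) - locT τ i) := by
    rw [← Finset.sum_neg_distrib]; simp
  rw [h2, this, h0]; simp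

lemma loc_theta {n : ℕ} (τ : Equiv.Perm (Fin n)) (j : Fin n) :
    loc τ (theta j) = MvPolynomial.X j := by
  classical
  rw [theta, map_sum]
  have h1 : ∑ F ∈ Finset.univ.filter (fun F : NE n => j ∈ F.1), loc τ (MvPolynomial.X F) =
      ∑ F ∈ (Finset.univ.filter (fun i : Fin n => τ.symm j ≤ i)).image (seg τ),
        loc τ (MvPolynomial.X F) := by
    symm
    apply Finset.sum_subset
    · intro F hF
      obtain ⟨i, hi, rfl⟩ := Finset.mem_image.1 hF
      simpa [mem_seg] using hi
    · intro F hF hF2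
      apply loc_X_of_not
      rintro i rfl
      apply hF2
      apply Finset.mem_image_of_mem
      simpa [mem_seg] using hF
  rw [h1, Finset.sum_image (fun a _ b _ h => seg_injective τ h)]
  simp only [loc_X_seg]
  have h2 : ∑ i ∈ Finset.univ.filter (fun i : Fin n => τ.symm j ≤ i),
      (locT τ i - locT τ (i + 1)) =
      ∑ i ∈ Finset.Ico (τ.symm j : ℕ) n, (locT τ i - locT τ (i + 1)) := by
    apply Finset.sum_bij (fun (i : Fin n) _ => (i : ℕ))
    · intro i hi
      rw [Finset.mem_filter] at hi
      exact Finset.mem_Ico.2 ⟨hi.2, i.2⟩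
    · intro a _ b _ h; exact Fin.ext h
    · intro b hb
      rw [Finset.mem_Ico] at hb
      exact ⟨⟨b, hb.2⟩, Finset.mem_filter.2 ⟨Finset.mem_univ _, hb.1⟩, rfl⟩
    · intros; rfl
  rw [h2, locT_sum _ _ (by omega), locT, dif_pos (by omega)]
  simp

lemma loc_evTheta {n : ℕ} (τ : Equiv.Perm (Fin n)) (p : MvPolynomial (Fin n) ℚ) :
    loc τ (evTheta n p) = p := by
  have : (loc τ).comp (evTheta n) = AlgHom.id ℚ _ := by
    ext i : 1
    simp [evTheta, loc_theta]
  exact DFunLike.congr_fun this p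

lemma loc_eta_ne {n : ℕ} (τ : Equiv.Perm (Fin n)) : loc τ (eta τ) ≠ 0 := by
  rw [eta, map_prod, Finset.prod_ne_zero_iff]
  intro F hF
  obtain ⟨i, -, rfl⟩ := mem_Rset.1 hF
  exact loc_X_seg_ne τ i

lemma loc_eta_zero {n : ℕ} {σ τ : Equiv.Perm (Fin n)} (h : ¬ key σ ≤ key τ) :
    loc τ (eta σ) = 0 := by
  by_contra hc
  apply h
  apply key_le
  intro i hi
  by_contra hj
  push Not at hj
  apply hc
  rw [eta, map_prod]
  exact Finset.prod_eq_zero (mem_Rset.2 ⟨i, hi, rfl⟩) (loc_X_of_not τ _ hj)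

lemma comb_zero {n : ℕ} (p : Equiv.Perm (Fin n) → MvPolynomial (Fin n) ℚ)
    (hp : comb p ∈ srIdeal n) : ∀ k : Lex (Fin n → Fin n), ∀ τ, key τ = k → p τ = 0 := by
  intro k
  induction k using WellFoundedLT.induction with
  | ind k ih =>
  intro τ hτ
  have h := loc_sr τ hp
  rw [comb, map_sum, Finset.sum_eq_single τ] at h
  · rw [map_mul, loc_evTheta] at h
    exact (mul_eq_zero.1 h).resolve_right (loc_eta_ne τ)
  · intro σ _ hσ
    rw [map_mul, loc_evTheta]
    by_cases hle : key σ ≤ key τ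
    · rw [ih (key σ) (hτ ▸ lt_of_le_of_ne hle (fun e => hσ (key_injective e))) σ rfl, zero_mul]
    · rw [loc_eta_zero hle, mul_zero]
  · simp

/-- The images of the descent monomials in the Chow ring. -/
noncomputable def etaBar {n : ℕ} (σ : Equiv.Perm (Fin n)) :
    MvPolynomial (NE n) ℚ ⧸ chowIdeal n := Ideal.Quotient.mk (chowIdeal n) (eta σ)

lemma sum_smul_etaBar {n : ℕ} (c : Equiv.Perm (Fin n) → ℚ) :
    ∑ σ, c σ • etaBar σ =
      Ideal.Quotient.mk (chowIdeal n) (comb fun σ => MvPolynomial.C (c σ)) := by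
  rw [comb, map_sum]
  apply Finset.sum_congr rfl
  intro σ _
  rw [etaBar, ← Ideal.Quotient.mkₐ_eq_mk ℚ, ← map_smul, Algebra.smul_def]
  simp [evTheta]

lemma linInd {n : ℕ} : LinearIndependent ℚ (etaBar (n := n)) := by
  rw [Fintype.linearIndependent_iff]
  intro c hc σ
  rw [sum_smul_etaBar, Ideal.Quotient.eq_zero_iff_mem] at hc
  obtain ⟨p, hp, h⟩ := chow_expand hc
  have h2 : comb (fun σ => MvPolynomial.C (c σ) - p σ) ∈ srIdeal n := by
    convert! h using 1
    simp [comb, sub_mul]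
  have h3 := comb_zero _ h2 _ σ rfl
  have h4 := congrArg MvPolynomial.constantCoeff h3
  simpa [hp] using h4

lemma sr_le {n : ℕ} : srIdeal n ≤ chowIdeal n := by
  rw [chowIdeal_eq]; exact le_sup_left

lemma evTheta_sub_mem {n : ℕ} (p : MvPolynomial (Fin n) ℚ) :
    evTheta n p - MvPolynomial.C (MvPolynomial.constantCoeff p) ∈ chowIdeal n := by
  have hth : ∀ i : Fin n, theta i ∈ chowIdeal n := fun i => by
    rw [chowIdeal_eq]
    exact le_sup_right (a := srIdeal n) (Ideal.subset_span ⟨i, rfl⟩)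
  induction p using MvPolynomial.induction_on with
  | C a => simp [evTheta, MvPolynomial.algebraMap_eq]
  | add p q hp hq =>
    convert! Ideal.add_mem _ hp hq using 1
    simp only [map_add]; ring
  | mul_X p i hp =>
    simpa [evTheta] using Ideal.mul_mem_left _ _ (hth i)

/-- Every polynomial is a rational combination of descent monomials modulo the Chow ideal. -/
lemma exists_coeff {n : ℕ} (q : MvPolynomial (NE n) ℚ) :
    ∃ c : Equiv.Perm (Fin n) → ℚ, q - ∑ σ, MvPolynomial.C (c σ) * eta σ ∈ chowIdeal n := by
  obtain ⟨p, hp⟩ := InM.all q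
  refine ⟨fun σ => MvPolynomial.constantCoeff (p σ), ?_⟩
  have : q - ∑ σ, MvPolynomial.C (MvPolynomial.constantCoeff (p σ)) * eta σ =
      (q - comb p) + ∑ σ, eta σ *
        (evTheta n (p σ) - MvPolynomial.C (MvPolynomial.constantCoeff (p σ))) := by
    simp only [comb, mul_comm (eta _), sub_mul, Finset.sum_sub_distrib]
    ring
  rw [this]
  exact Ideal.add_mem _ (sr_le hp)
    (Ideal.sum_mem _ fun σ _ => Ideal.mul_mem_left _ _ (evTheta_sub_mem _))

lemma mk_C_mul {n : ℕ} (a : ℚ) (σ : Equiv.Perm (Fin n)) :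
    Ideal.Quotient.mk (chowIdeal n) (MvPolynomial.C a * eta σ) = a • etaBar σ := by
  rw [etaBar, ← Ideal.Quotient.mkₐ_eq_mk ℚ, ← map_smul, MvPolynomial.smul_eq_C_mul]

lemma span_top {n : ℕ} : Submodule.span ℚ (Set.range (etaBar (n := n))) = ⊤ := by
  rw [eq_top_iff]
  rintro x -
  obtain ⟨q, rfl⟩ := Ideal.Quotient.mk_surjective x
  obtain ⟨c, hc⟩ := exists_coeff q
  rw [Ideal.Quotient.eq.2 hc, map_sum]
  refine Submodule.sum_mem _ fun σ _ => ?_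
  rw [mk_C_mul]
  exact Submodule.smul_mem _ _ (Submodule.subset_span ⟨σ, rfl⟩)

lemma eta_homog {n : ℕ} (σ : Equiv.Perm (Fin n)) : (eta σ).IsHomogeneous (des σ) := by
  have := MvPolynomial.IsHomogeneous.prod (Rset σ)
    (fun G => (MvPolynomial.X G : MvPolynomial (NE n) ℚ)) (fun _ => 1)
    (fun G _ => MvPolynomial.isHomogeneous_X ℚ G)
  simpa [card_Rset, eta] using this

section
attribute [local instance] MvPolynomial.gradedAlgebra

lemma component_mem {n : ℕ} {q : MvPolynomial (NE n) ℚ} (hq : q ∈ chowIdeal n) (j : ℕ) :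
    MvPolynomial.homogeneousComponent j q ∈ chowIdeal n := by
  have hh : (chowIdeal n).IsHomogeneous (MvPolynomial.homogeneousSubmodule (NE n) ℚ) := by
    apply Ideal.homogeneous_span
    rintro x (⟨F, G, -, -, rfl⟩ | ⟨i, rfl⟩)
    · exact ⟨2, (MvPolynomial.isHomogeneous_X ℚ F).mul (MvPolynomial.isHomogeneous_X ℚ G)⟩
    · exact ⟨1, MvPolynomial.IsHomogeneous.sum _ _ _ fun F _ => MvPolynomial.isHomogeneous_X ℚ F⟩
  have := hh j hq
  rwa [← MvPolynomial.decomposition.decompose'_apply]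
end

lemma span_homog {n : ℕ} (j : ℕ) :
    Submodule.span ℚ (Ideal.Quotient.mk (chowIdeal n) ''
            {q : MvPolynomial (NE n) ℚ | q.IsHomogeneous j}) =
    Submodule.span ℚ (Set.range
      (fun σ : {σ : Equiv.Perm (Fin n) // des σ = j} => etaBar σ.1)) := by
  apply le_antisymm
  · rw [Submodule.span_le]
    rintro _ ⟨q, hq, rfl⟩
    obtain ⟨c, hc⟩ := exists_coeff q
    have h := component_mem hc j
    rw [map_sub, MvPolynomial.homogeneousComponent_of_mem hq, if_pos rfl] at h
    rw [Ideal.Quotient.eq.2 h, map_sum, map_sum]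
    refine Submodule.sum_mem _ fun σ _ => ?_
    rw [MvPolynomial.homogeneousComponent_C_mul,
      MvPolynomial.homogeneousComponent_of_mem (eta_homog σ)]
    split_ifs with hj
    · rw [mk_C_mul]
      exact Submodule.smul_mem _ _ (Submodule.subset_span ⟨⟨σ, hj.symm⟩, rfl⟩)
    · simp
  · rw [Submodule.span_le]
    rintro _ ⟨⟨σ, rfl⟩, rfl⟩
    exact Submodule.subset_span ⟨eta σ, eta_homog σ, rfl⟩

theorem stmt19 (n : ℕ) :
    (∀ j : ℕ,
      Module.finrank ℚ
        (Submodule.span ℚ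
          (Ideal.Quotient.mk (chowIdeal n) ''
            {q : MvPolynomial {F : Finset (Fin n) // F.Nonempty} ℚ |
              q.IsHomogeneous j})) =
        Nat.card {σ : Equiv.Perm (Fin n) // des σ = j}) ∧
    Module.finrank ℚ
      (MvPolynomial {F : Finset (Fin n) // F.Nonempty} ℚ ⧸ chowIdeal n) = Nat.factorial n := by
  classical
  refine ⟨fun j => ?_, ?_⟩
  · have h1 := finrank_span_eq_card (linInd (n := n).comp
      (fun σ : {σ : Equiv.Perm (Fin n) // des σ = j} => σ.1) Subtype.val_injective)
    rw [Nat.card_eq_fintype_card, ← h1]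
    exact congrArg (fun S : Submodule ℚ (MvPolynomial (NE n) ℚ ⧸ chowIdeal n) =>
      Module.finrank ℚ S) (span_homog j)
  · have h1 := finrank_span_eq_card (linInd (n := n))
    rw [span_top, finrank_top, Fintype.card_perm, Fintype.card_fin] at h1
    exact h1
end
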